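/- Let G₀ be a discrete convergence group acting on a compact metrizable space M, let J₁, J₋₁ ≤ G₀ be geometrically finite subgroups, let f ∈ Homeo(M) generate an infinite cyclic discrete convergence group with f J₋₁ f⁻¹ = J₁, suppose G₀ is in HNN ping-pong position with respect to f, J₁, J₋₁ with closed sets B₁, B₋₁, and let G = ⟨G₀, f⟩ act on M as a convergence group. If either G or G₀ is geometrically finite, then the only limit points of G in ∂B₁ are limit points of J₁, and the only limit points of G in ∂B₋₁ are limit points of J₋₁; that is, Λ(G) ∩ ∂B₁ = Λ(J₁) and Λ(G) ∩ ∂B₋₁ = Λ(J₋₁). -/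

import Mathlib

open Filter Topology Set

namespace ConvergenceGroups

variable {M : Type*} [TopologicalSpace M]

/-- The group of self-homeomorphisms of `M`, with `(g * h) x = g (h x)`. -/
instance : Group (M ≃ₜ M) where
  mul g h := h.trans g
  one := Homeomorph.refl M
  inv := Homeomorph.symm
  mul_assoc _ _ _ := rfl
  one_mul _ := Homeomorph.ext fun _ => rfl
  mul_one _ := Homeomorph.ext fun _ => rfl
  inv_mul_cancel g := Homeomorph.ext fun x => g.symm_apply_apply x

/-- The inclusion of the self-homeomorphisms of `M` into the continuous self-maps of `M`;
the latter carries the compact-open topology. -/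
def toCM (g : M ≃ₜ M) : C(M, M) := ⟨⇑g, g.continuous⟩

/-- `(g k)` is a convergence sequence with attracting point `zp` and repelling point `zm`:
the maps `g k` converge to the constant map `zp` uniformly on compact subsets of
`M ∖ {zm}`. -/
def IsConvSeq (g : ℕ → M ≃ₜ M) (zp zm : M) : Prop :=
  ∀ K : Set M, IsCompact K → zm ∉ K → ∀ U ∈ 𝓝 zp,
    ∀ᶠ k in atTop, ∀ x ∈ K, g k x ∈ U

/-- `(g k)` converges in the compact-open topology to a homeomorphism. -/
def TendstoHomeo (g : ℕ → M ≃ₜ M) : Prop :=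
  ∃ h : M ≃ₜ M, Tendsto (fun k => toCM (g k)) atTop (𝓝 (toCM h))

/-- `G` acts on `M` as a convergence group: every sequence of pairwise distinct elements of
`G` has a subsequence which either converges in the compact-open topology to a
homeomorphism, or is a convergence sequence. -/
def IsConvGroup (G : Subgroup (M ≃ₜ M)) : Prop :=
  ∀ g : ℕ → M ≃ₜ M, (∀ k, g k ∈ G) → Function.Injective g →
    ∃ φ : ℕ → ℕ, StrictMono φ ∧
      (TendstoHomeo (g ∘ φ) ∨ ∃ zp zm : M, IsConvSeq (g ∘ φ) zp zm)

/-- `G` acts on `M` as a discrete convergence group: every sequence of pairwise distinct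
elements of `G` has a subsequence which is a convergence sequence. -/
def IsDiscreteConvGroup (G : Subgroup (M ≃ₜ M)) : Prop :=
  ∀ g : ℕ → M ≃ₜ M, (∀ k, g k ∈ G) → Function.Injective g →
    ∃ φ : ℕ → ℕ, StrictMono φ ∧ ∃ zp zm : M, IsConvSeq (g ∘ φ) zp zm

/-- The limit set `Λ(G)`: the set of all attracting points of convergence sequences in `G`. -/
def limitSet (G : Subgroup (M ≃ₜ M)) : Set M :=
  {zp | ∃ g : ℕ → M ≃ₜ M, (∀ k, g k ∈ G) ∧ Function.Injective g ∧
    ∃ zm : M, IsConvSeq g zp zm}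

/-- `x` is a conical limit point for `G`: there is a sequence of pairwise distinct elements
`g k` of `G` such that for every `z ≠ x` the pairs `(g k x, g k z)` remain in a compact
subset of `(M × M) ∖ Δ`. -/
def IsConicalLimitPt (G : Subgroup (M ≃ₜ M)) (x : M) : Prop :=
  ∃ g : ℕ → M ≃ₜ M, (∀ k, g k ∈ G) ∧ Function.Injective g ∧
    ∀ z : M, z ≠ x → ∃ K : Set (M × M), IsCompact K ∧ (∀ p ∈ K, p.1 ≠ p.2) ∧
      ∀ k, (g k x, g k z) ∈ K

/-- `g` is elliptic: the closure of the cyclic group generated by `g` is compact in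
`Homeo(M)` (viewed inside `C(M, M)` with the compact-open topology). -/
def IsEllipticElem (g : M ≃ₜ M) : Prop :=
  IsCompact (closure (Set.range fun n : ℤ => toCM (g ^ n))) ∧
    closure (Set.range fun n : ℤ => toCM (g ^ n)) ⊆ Set.range (toCM (M := M))

/-- `g` is parabolic: not elliptic, and fixes exactly one point of `M`. -/
def IsParabolicElem (g : M ≃ₜ M) : Prop :=
  ¬IsEllipticElem g ∧ ∃! x : M, g x = x

/-- `g` is loxodromic: not elliptic, and fixes exactly two points of `M`. -/
def IsLoxodromicElem (g : M ≃ₜ M) : Prop :=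
  ¬IsEllipticElem g ∧ ∃ a b : M, a ≠ b ∧ {x : M | g x = x} = {a, b}

/-- `p` is a parabolic point for `G`: it is the fixed point of a parabolic element of `G`. -/
def IsParabolicPt (G : Subgroup (M ≃ₜ M)) (p : M) : Prop :=
  ∃ g ∈ G, IsParabolicElem g ∧ g p = p

/-- `p` is a bounded parabolic point for `G`: it is a parabolic point and the quotient of
`Λ(G) ∖ {p}` by the stabilizer of `p` in `G` is compact. -/
def IsBoundedParabolicPt (G : Subgroup (M ≃ₜ M)) (p : M) : Prop :=
  IsParabolicPt G p ∧
    ∃ K : Set M, IsCompact K ∧ K ⊆ limitSet G \ {p} ∧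
      ∀ x ∈ limitSet G \ {p}, ∃ h ∈ G, h p = p ∧ h x ∈ K

/-- `G` is geometrically finite: every point of `Λ(G)` is a conical limit point or a
bounded parabolic point. -/
def IsGeomFinite (G : Subgroup (M ≃ₜ M)) : Prop :=
  ∀ x ∈ limitSet G, IsConicalLimitPt G x ∨ IsBoundedParabolicPt G x

/-- `J` is a fully quasi-convex subgroup of `G`: `J ≤ G`, `J` acts geometrically finitely,
and `g Λ(J) ∩ Λ(J) = ∅` for all but finitely many left cosets `gJ`. -/
def IsFullyQuasiconvex (G J : Subgroup (M ≃ₜ M)) : Prop :=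
  J ≤ G ∧ IsGeomFinite J ∧
    ∃ F : Set (M ≃ₜ M), F.Finite ∧ ∀ g ∈ G,
      (⇑g '' limitSet J ∩ limitSet J).Nonempty → ∃ f ∈ F, ∃ j ∈ J, g = f * j

/-- `G₁` and `G₂` are in AFP ping-pong position with respect to `J = G₁ ∩ G₂`, witnessed by
the closed sets `B₁`, `B₂`. -/
structure AFPPingPong (G₁ G₂ J : Subgroup (M ≃ₜ M)) (B₁ B₂ : Set M) : Prop where
  isClosed₁ : IsClosed B₁
  isClosed₂ : IsClosed B₂
  int_nonempty₁ : (interior B₁).Nonempty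
  int_nonempty₂ : (interior B₂).Nonempty
  int_disjoint : interior B₁ ∩ interior B₂ = ∅
  inv₁ : ∀ j ∈ J, ⇑j '' B₁ = B₁
  inv₂ : ∀ j ∈ J, ⇑j '' B₂ = B₂
  pp₁ : ∀ g ∈ G₁, g ∉ J → ⇑g '' B₁ ⊆ interior B₂
  pp₂ : ∀ g ∈ G₂, g ∉ J → ⇑g '' B₂ ⊆ interior B₁
  lim₁ : limitSet G₁ \ limitSet J ⊆ interior B₂
  lim₂ : limitSet G₂ \ limitSet J ⊆ interior B₁

/-- `G₀` is in HNN ping-pong position with respect to `f`, `J₁`, `J₋₁`, witnessed by the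
closed sets `B₁`, `Bm` (where `Bm` plays the role of `B₋₁`). -/
structure HNNPingPong (G₀ J₁ Jm : Subgroup (M ≃ₜ M)) (f : M ≃ₜ M) (B₁ Bm : Set M) :
    Prop where
  isClosed₁ : IsClosed B₁
  isClosedm : IsClosed Bm
  int_nonempty₁ : (interior B₁).Nonempty
  int_nonemptym : (interior Bm).Nonempty
  int_disjoint : interior B₁ ∩ interior Bm = ∅
  inv₁ : ∀ j ∈ J₁, ⇑j '' B₁ = B₁
  invm : ∀ j ∈ Jm, ⇑j '' Bm = Bm
  prec₁ : ∀ g ∈ G₀, g ∉ J₁ → ⇑g '' B₁ ∩ B₁ = ∅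
  precm : ∀ g ∈ G₀, g ∉ Jm → ⇑g '' Bm ∩ Bm = ∅
  cross : ∀ g ∈ G₀, ⇑g '' B₁ ∩ Bm = ∅
  mapf : ⇑f '' ((B₁ ∪ Bm)ᶜ ∪ B₁) = interior B₁
  lim₁ : limitSet G₀ ∩ B₁ = limitSet J₁
  limm : limitSet G₀ ∩ Bm = limitSet Jm
  proper : (⋃ g ∈ G₀, ⇑g '' (B₁ ∪ Bm))ᶜ.Nonempty

/-- A letter of type `i` (`i = 0` for `G₁`, `i = 1` for `G₂`) for amalgamated free product
normal forms: an element of `G_{i+1} ∖ J`. -/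
def AFPLetter (G₁ G₂ J : Subgroup (M ≃ₜ M)) (i : Fin 2) (g : M ≃ₜ M) : Prop :=
  g ∈ (if i = 0 then G₁ else G₂) ∧ g ∉ J

/-- `h` is an `(i,j)`-form: a product of a nonempty alternating list of letters, whose first
letter lies in `G_i ∖ J` and whose last letter lies in `G_j ∖ J` (indices shifted so that
`0` stands for `G₁` and `1` for `G₂`). -/
def IsIJForm (G₁ G₂ J : Subgroup (M ≃ₜ M)) (i j : Fin 2) (h : M ≃ₜ M) : Prop :=
  ∃ l : List (M ≃ₜ M), l ≠ [] ∧ l.prod = h ∧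
    (∀ g ∈ l, AFPLetter G₁ G₂ J 0 g ∨ AFPLetter G₁ G₂ J 1 g) ∧
    l.Chain' (fun a b => ∀ c : Fin 2, AFPLetter G₁ G₂ J c a → AFPLetter G₁ G₂ J (1 - c) b) ∧
    (∀ hne : l ≠ [], AFPLetter G₁ G₂ J i (l.head hne)) ∧
    (∀ hne : l ≠ [], AFPLetter G₁ G₂ J j (l.getLast hne))

section Subsequences

theorem exists_strictMono_const_or_injective {α : Type*} (u : ℕ → α) :
    ∃ φ : ℕ → ℕ, StrictMono φ ∧
      ((∃ a, ∀ k, u (φ k) = a) ∨ Function.Injective (u ∘ φ)) := by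
  obtain ⟨φ, h | h⟩ := exists_increasing_or_nonincreasing_subseq (fun a b : α => a = b) u
  · refine ⟨φ, φ.strictMono, Or.inl ⟨u (φ 0), fun k => ?_⟩⟩
    rcases Nat.eq_zero_or_pos k with rfl | hk
    · rfl
    · exact (h 0 k hk).symm
  · refine ⟨φ, φ.strictMono, Or.inr fun m n hmn => ?_⟩
    rcases lt_trichotomy m n with hlt | heq | hlt
    · exact (h m n hlt hmn).elim
    · exact heq
    · exact (h n m hlt hmn.symm).elim

theorem exists_strictMono_or {p q : ℕ → Prop} (h : ∀ k, p k ∨ q k) :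
    ∃ φ : ℕ → ℕ, StrictMono φ ∧ ((∀ k, p (φ k)) ∨ ∀ k, q (φ k)) := by
  by_cases hf : ∃ᶠ k in atTop, p k
  · obtain ⟨φ, hφ, hp⟩ := extraction_of_frequently_atTop hf
    exact ⟨φ, hφ, Or.inl hp⟩
  · rw [not_frequently] at hf
    obtain ⟨φ, hφ, hq⟩ := extraction_of_eventually_atTop hf
    exact ⟨φ, hφ, Or.inr fun k => (h _).resolve_left (hq k)⟩

theorem exists_strictMono_coset {α : Type*} [Group α] (J : Subgroup α) (u : ℕ → α) :
    ∃ φ : ℕ → ℕ, StrictMono φ ∧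
      ((∀ k, (u (φ 0))⁻¹ * u (φ k) ∈ J) ∨
        ∀ m n, m ≠ n → (u (φ m))⁻¹ * u (φ n) ∉ J) := by
  have htr : IsTrans α (fun a b : α => a⁻¹ * b ∈ J) := ⟨fun a b c hab hbc => by
    have := J.mul_mem hab hbc
    simpa [mul_assoc] using this⟩
  obtain ⟨φ, h | h⟩ := exists_increasing_or_nonincreasing_subseq (fun a b : α => a⁻¹ * b ∈ J) u
  · refine ⟨φ, φ.strictMono, Or.inl fun k => ?_⟩
    rcases Nat.eq_zero_or_pos k with rfl | hk
    · simp
    · exact h 0 k hk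
  · refine ⟨φ, φ.strictMono, Or.inr fun m n hmn hJ => ?_⟩
    rcases lt_or_gt_of_ne hmn with hlt | hlt
    · exact h m n hlt hJ
    · exact h n m hlt (by simpa using J.inv_mem hJ)

end Subsequences

section Basic

theorem exists_ne_ne {α : Type*} [Infinite α] (a b : α) : ∃ y : α, y ≠ a ∧ y ≠ b := by
  obtain ⟨y, hy⟩ := (Set.toFinite ({a, b} : Set α)).exists_notMem
  exact ⟨y, by simpa using hy⟩

theorem mul_app (g h : M ≃ₜ M) (x : M) : (g * h) x = g (h x) := rfl

theorem inv_app (g : M ≃ₜ M) (x : M) : g⁻¹ (g x) = x := g.symm_apply_apply x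

theorem app_inv (g : M ≃ₜ M) (x : M) : g (g⁻¹ x) = x := g.apply_symm_apply x

theorem inv_app_eq_iff {g : M ≃ₜ M} {x y : M} : g⁻¹ x = y ↔ x = g y :=
  ⟨fun h => by rw [← h, app_inv], fun h => by rw [h, inv_app]⟩

theorem mem_image_iff_inv {g : M ≃ₜ M} {S : Set M} {x : M} : x ∈ ⇑g '' S ↔ g⁻¹ x ∈ S := by
  constructor
  · rintro ⟨y, hy, rfl⟩
    rwa [inv_app]
  · intro h
    exact ⟨_, h, app_inv g x⟩

variable {g : ℕ → M ≃ₜ M} {zp zm : M}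

theorem IsConvSeq.comp (h : IsConvSeq g zp zm) {φ : ℕ → ℕ} (hφ : StrictMono φ) :
    IsConvSeq (g ∘ φ) zp zm := fun K hK hz U hU =>
  hφ.tendsto_atTop.eventually (h K hK hz U hU)

theorem IsConvSeq.mul_left (h : IsConvSeq g zp zm) (p : M ≃ₜ M) :
    IsConvSeq (fun k => p * g k) (p zp) zm := fun K hK hz U hU =>
  h K hK hz (⇑p ⁻¹' U) (p.continuous.continuousAt.preimage_mem_nhds hU)

theorem IsConvSeq.mul_right (h : IsConvSeq g zp zm) (p : M ≃ₜ M) :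
    IsConvSeq (fun k => g k * p) zp (p⁻¹ zm) := by
  intro K hK hz U hU
  have hK' : IsCompact (⇑p '' K) := hK.image p.continuous
  have hz' : zm ∉ ⇑p '' K := fun hc => hz (mem_image_iff_inv.1 hc)
  filter_upwards [h _ hK' hz' U hU] with k hk x hx
  exact hk _ (mem_image_of_mem _ hx)

variable [CompactSpace M]

theorem IsConvSeq.eventually_of_nhds (h : IsConvSeq g zp zm) {U V : Set M} (hU : U ∈ 𝓝 zp)
    (hV : V ∈ 𝓝 zm) : ∀ᶠ k in atTop, ∀ x ∉ V, g k x ∈ U := by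
  filter_upwards [h (interior V)ᶜ isOpen_interior.isClosed_compl.isCompact
    (fun hc => hc (mem_interior_iff_mem_nhds.2 hV)) U hU] with k hk x hx
  exact hk x fun hc => hx (interior_subset hc)

variable [T2Space M]

theorem IsConvSeq.tendsto (h : IsConvSeq g zp zm) {y : ℕ → M} {y₀ : M}
    (hy : Tendsto y atTop (𝓝 y₀)) (hne : y₀ ≠ zm) :
    Tendsto (fun k => g k (y k)) atTop (𝓝 zp) := by
  intro U hU
  obtain ⟨V, W, hV, hW, hyV, hzW, hVW⟩ := t2_separation hne
  change ∀ᶠ k in atTop, g k (y k) ∈ U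
  filter_upwards [h.eventually_of_nhds hU (hW.mem_nhds hzW), hy (hV.mem_nhds hyV)] with k hk hyk
  exact hk _ fun hc => (disjoint_left.1 hVW) hyk hc

theorem IsConvSeq.tendsto_const (h : IsConvSeq g zp zm) {y : M} (hne : y ≠ zm) :
    Tendsto (fun k => g k y) atTop (𝓝 zp) := h.tendsto tendsto_const_nhds hne

theorem IsConvSeq.inv (h : IsConvSeq g zp zm) : IsConvSeq (fun k => (g k)⁻¹) zm zp := by
  intro K hK hz U hU
  filter_upwards [h.eventually_of_nhds (hK.isClosed.isOpen_compl.mem_nhds hz) hU] with k hk x hx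
  by_contra hc
  exact hk _ hc (by rwa [app_inv])

theorem IsConvSeq.attracting_unique [Infinite M] {zp' zm' : M} (h : IsConvSeq g zp zm)
    (h' : IsConvSeq g zp' zm') : zp = zp' := by
  obtain ⟨y, hy, hy'⟩ := exists_ne_ne zm zm'
  exact tendsto_nhds_unique (h.tendsto_const hy) (h'.tendsto_const hy')

theorem IsConvSeq.repelling_unique [Infinite M] {zp' zm' : M} (h : IsConvSeq g zp zm)
    (h' : IsConvSeq g zp' zm') : zm = zm' := h.inv.attracting_unique h'.inv

/-- If `g k` fixes a point other than the repelling one, it is the attracting one. -/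
theorem IsConvSeq.eq_of_fixed (h : IsConvSeq g zp zm) {y : M} (hy : ∀ k, g k y = y) :
    y = zp ∨ y = zm := by
  by_cases hne : y = zm
  · exact Or.inr hne
  · refine Or.inl (tendsto_nhds_unique ?_ (h.tendsto_const hne))
    simp [hy]

end Basic

section LimitSet

variable {G H : Subgroup (M ≃ₜ M)}

theorem IsDiscreteConvGroup.mono (hG : IsDiscreteConvGroup G) (hHG : H ≤ G) :
    IsDiscreteConvGroup H := fun g hg hi => hG g (fun k => hHG (hg k)) hi

theorem limitSet_mono (hHG : H ≤ G) : limitSet H ⊆ limitSet G := by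
  rintro x ⟨g, hg, hi, zm, h⟩
  exact ⟨g, fun k => hHG (hg k), hi, zm, h⟩

theorem app_mem_limitSet {p : M ≃ₜ M} (hp : p ∈ G) {x : M} (hx : x ∈ limitSet G) :
    p x ∈ limitSet G := by
  obtain ⟨g, hg, hi, zm, h⟩ := hx
  exact ⟨fun k => p * g k, fun k => G.mul_mem hp (hg k),
    fun m n hmn => hi (mul_left_cancel hmn), zm, h.mul_left p⟩

theorem app_mem_limitSet_iff {p : M ≃ₜ M} (hp : p ∈ G) {x : M} :
    p x ∈ limitSet G ↔ x ∈ limitSet G :=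
  ⟨fun h => by simpa [inv_app] using app_mem_limitSet (G.inv_mem hp) h, app_mem_limitSet hp⟩

theorem app_mem_limitSet_of_conj {p : M ≃ₜ M} (hp : ∀ x ∈ H, p * x * p⁻¹ ∈ G) {x : M}
    (hx : x ∈ limitSet H) : p x ∈ limitSet G := by
  obtain ⟨g, hg, hi, zm, h⟩ := hx
  refine ⟨fun k => p * g k * p⁻¹, fun k => hp _ (hg k),
    fun m n hmn => hi ?_, _, (h.mul_left p).mul_right p⁻¹⟩
  simpa using hmn

variable [CompactSpace M] [T2Space M]

theorem IsConvSeq.repelling_mem_limitSet {g : ℕ → M ≃ₜ M} {zp zm : M} (h : IsConvSeq g zp zm)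
    (hg : ∀ k, g k ∈ G) (hi : Function.Injective g) : zm ∈ limitSet G :=
  ⟨fun k => (g k)⁻¹, fun k => G.inv_mem (hg k), fun _ _ hmn => hi (inv_injective hmn), _, h.inv⟩

end LimitSet

section Discrete

theorem exists_injective_seq {α : Type*} {S : ℕ → Set α} (hS : Antitone S)
    (hinf : ∀ n, (S n).Infinite) : ∃ u : ℕ → α, Function.Injective u ∧ ∀ n, u n ∈ S n := by
  obtain ⟨f, hf, hr⟩ := exists_seq_of_forall_finset_exists
    (fun x : ℕ × α => x.2 ∈ S x.1) (fun x y => x.1 < y.1 ∧ x.2 ≠ y.2) (by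
      classical
      intro s _
      obtain ⟨y, hy, hys⟩ := (hinf (s.sup Prod.fst + 1)).exists_notMem_finset (s.image Prod.snd)
      refine ⟨(s.sup Prod.fst + 1, y), hy, fun x hx => ⟨?_, ?_⟩⟩
      · exact Nat.lt_succ_of_le (Finset.le_sup (f := Prod.fst) hx)
      · rintro rfl
        exact hys (Finset.mem_image_of_mem _ hx))
  have hmono : StrictMono fun n => (f n).1 := fun m n hmn => (hr m n hmn).1
  refine ⟨fun n => (f n).2, fun m n hmn => ?_, fun n => hS (hmono.le_apply) (hf n)⟩
  rcases lt_trichotomy m n with hlt | heq | hlt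
  · exact ((hr m n hlt).2 hmn).elim
  · exact heq
  · exact ((hr n m hlt).2 hmn.symm).elim

variable [CompactSpace M] [T2Space M] {J : Subgroup (M ≃ₜ M)}

theorem finite_separating (hJ : IsDiscreteConvGroup J) {q : M} {N V C D : Set M}
    (hN : IsClosed N) (hV : IsClosed V) (hC : IsClosed C) (hD : IsClosed D) (hNV : Disjoint N V)
    (hCD : ∀ x ∈ C, x ∈ D → x ∉ limitSet J) (hq : q ∉ limitSet J) :
    {h | h ∈ J ∧ h⁻¹ q ∈ N ∧ (∃ v ∈ V, h v ∈ C) ∧ ∃ v ∈ V, h v ∈ D}.Finite := by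
  by_contra hinf
  set u := Set.Infinite.natEmbedding _ hinf
  have hu : Function.Injective fun k => (u k : M ≃ₜ M) := Subtype.val_injective.comp u.injective
  obtain ⟨φ, hφ, zp, zm, h⟩ := hJ _ (fun k => (u k).2.1) hu
  have hi := hu.comp hφ.injective
  have hzp : zp ∈ limitSet J := ⟨_, fun k => (u (φ k)).2.1, hi, zm, h⟩
  have ht := h.inv.tendsto_const (y := q) (fun hc => hq (hc ▸ hzp))
  have hzm : zm ∈ N := hN.mem_of_tendsto ht (Eventually.of_forall fun k => (u (φ k)).2.2.1)
  have hV' : Vᶜ ∈ 𝓝 zm := hV.isOpen_compl.mem_nhds (disjoint_left.1 hNV hzm)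
  by_cases hc : zp ∈ C
  · have hd : Dᶜ ∈ 𝓝 zp := hD.isOpen_compl.mem_nhds fun hd => hCD _ hc hd hzp
    obtain ⟨k, hk⟩ := (h.eventually_of_nhds hd hV').exists
    obtain ⟨v, hv, hv'⟩ := (u (φ k)).2.2.2.2
    exact hk v (not_not.2 hv) hv'
  · have hd : Cᶜ ∈ 𝓝 zp := hC.isOpen_compl.mem_nhds hc
    obtain ⟨k, hk⟩ := (h.eventually_of_nhds hd hV').exists
    obtain ⟨v, hv, hv'⟩ := (u (φ k)).2.2.2.1
    exact hk v (not_not.2 hv) hv'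

theorem countable_of_notMem_limitSet [SecondCountableTopology M] (hJ : IsDiscreteConvGroup J)
    {q : M} (hq : q ∉ limitSet J) : (J : Set (M ≃ₜ M)).Countable := by
  have hcov : ∀ h ∈ J, ∃ b ∈ TopologicalSpace.countableBasis M, h q ∈ b ∧
      {h' | h' ∈ J ∧ h' q ∈ b}.Finite := by
    intro h hh
    obtain ⟨U, hU⟩ := (𝓝 (h q)).exists_antitone_basis
    by_contra! hcon
    have hinf : ∀ n, {h' | h' ∈ J ∧ h' q ∈ U n}.Infinite := by
      intro n
      obtain ⟨b, hb, hqb, hbU⟩ := (TopologicalSpace.isBasis_countableBasis M).mem_nhds_iff.1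
        (hU.1.mem_of_mem (i := n) trivial)
      exact (hcon b hb hqb).mono fun h' hh' => ⟨hh'.1, hbU hh'.2⟩
    obtain ⟨u, hu, huS⟩ := exists_injective_seq
      (S := fun n => {h' | h' ∈ J ∧ h' q ∈ U n})
      (fun m n hmn h' hh' => ⟨hh'.1, hU.2 hmn hh'.2⟩) hinf
    obtain ⟨φ, hφ, zp, zm, hc⟩ := hJ u (fun k => (huS k).1) hu
    have hi := hu.comp hφ.injective
    have hzp : zp ∈ limitSet J := ⟨_, fun k => (huS (φ k)).1, hi, zm, hc⟩
    have hzm : zm ∈ limitSet J := hc.repelling_mem_limitSet (fun k => (huS (φ k)).1) hi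
    have h1 := hc.tendsto_const (y := q) (fun hc => hq (hc ▸ hzm))
    have h2 : Tendsto (fun k => u (φ k) q) atTop (𝓝 (h q)) :=
      (hU.tendsto fun k => (huS k).2).comp hφ.tendsto_atTop
    have := tendsto_nhds_unique h1 h2
    rw [this, app_mem_limitSet_iff hh] at hzp
    exact hq hzp
  have hsub : (J : Set (M ≃ₜ M)) ⊆ ⋃ b ∈ {b ∈ TopologicalSpace.countableBasis M |
      {h' | h' ∈ J ∧ h' q ∈ b}.Finite}, {h' | h' ∈ J ∧ h' q ∈ b} := by
    intro h hh
    obtain ⟨b, hb, hqb, hfin⟩ := hcov h hh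
    exact mem_biUnion (x := b) ⟨hb, hfin⟩ ⟨hh, hqb⟩
  exact (((TopologicalSpace.countable_countableBasis M).mono (sep_subset _ _)).biUnion
    fun b hb => hb.2.countable).mono hsub

end Discrete

section Conical

theorem IsParabolicElem.not_isOfFinOrder [T2Space M] {g : M ≃ₜ M} (hg : IsParabolicElem g) :
    ¬IsOfFinOrder g := by
  intro hf
  have hfin : (Set.range fun n : ℤ => toCM (g ^ n)).Finite := by
    have h1 := (finite_zpowers.2 hf).image toCM
    rwa [Subgroup.coe_zpowers, ← Set.range_comp] at h1
  refine hg.1 ⟨?_, ?_⟩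
  · rw [hfin.isClosed.closure_eq]
    exact hfin.isCompact
  · rw [hfin.isClosed.closure_eq]
    rintro _ ⟨n, rfl⟩
    exact ⟨_, rfl⟩

variable [CompactSpace M] [T2Space M] {J : Subgroup (M ≃ₜ M)}

theorem isConicalLimitPt_of_isConvSeq {z a b : M} {g : ℕ → M ≃ₜ M}
    (hg : ∀ k, g k ∈ J) (hi : Function.Injective g) (h : IsConvSeq g b z)
    (ha : Tendsto (fun k => g k z) atTop (𝓝 a)) (hab : a ≠ b) : IsConicalLimitPt J z := by
  refine ⟨g, hg, hi, fun y hy => ?_⟩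
  have ht : Tendsto (fun k => (g k z, g k y)) atTop (𝓝 (a, b)) :=
    ha.prodMk_nhds (h.tendsto_const hy)
  refine ⟨_, ht.isCompact_insert_range, ?_, fun k => Or.inr ⟨k, rfl⟩⟩
  rintro p (rfl | ⟨k, rfl⟩)
  · exact hab
  · exact fun hc => hy ((g k).injective hc).symm

theorem false_of_isConvSeq_of_pow {t : ℕ → M ≃ₜ M} {a b : M} (h : IsConvSeq t b a) (hab : a ≠ b)
    {p : ℕ → M} (hp : Tendsto p atTop (𝓝 a))
    (hpow : ∀ n, ∃ s : ℕ → M ≃ₜ M, (∀ k, ∃ m : ℕ, s k = t n ^ m) ∧ IsConvSeq s (p n) (p n)) :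
    False := by
  obtain ⟨V, W, hV, hW, haV, hbW, hVW⟩ := t2_separation hab
  have hVW' : ∀ x ∈ closure W, x ∉ V := fun x hx hxV =>
    disjoint_left.1 (hVW.closure_right hV) hxV hx
  obtain ⟨n, hn, hpn⟩ := ((h.eventually_of_nhds (hW.mem_nhds hbW) (hV.mem_nhds haV)).and
    (hp (hV.mem_nhds haV))).exists
  obtain ⟨s, hs, hsc⟩ := hpow n
  have hinv : ∀ m : ℕ, (t n ^ m) b ∈ closure W := by
    intro m
    induction m with
    | zero => exact subset_closure hbW
    | succ m ih =>
      rw [pow_succ', mul_app]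
      exact subset_closure (hn _ (hVW' _ ih))
  have hpn' : p n ∉ closure W := fun hc => hVW' _ hc hpn
  have ht := hsc.tendsto_const (y := b) (fun hc => hpn' (hc ▸ subset_closure hbW))
  refine hpn' (isClosed_closure.mem_of_tendsto ht (Eventually.of_forall fun k => ?_))
  obtain ⟨m, hm⟩ := hs k
  rw [hm]
  exact hinv m

variable [Infinite M]

theorem IsConicalLimitPt.exists_isConvSeq [SecondCountableTopology M]
    (hJ : IsDiscreteConvGroup J) {z : M}
    (hz : IsConicalLimitPt J z) : ∃ g : ℕ → M ≃ₜ M, (∀ k, g k ∈ J) ∧ Function.Injective g ∧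
      ∃ a b : M, a ≠ b ∧ IsConvSeq g b z ∧ Tendsto (fun k => g k z) atTop (𝓝 a) := by
  obtain ⟨g, hg, hi, hK⟩ := hz
  obtain ⟨φ, hφ, b, e, h⟩ := hJ g hg hi
  have hez : e = z := by
    by_contra hne
    obtain ⟨y, hyz, hye⟩ := exists_ne_ne z e
    obtain ⟨K, hKc, hKd, hKm⟩ := hK y hyz
    have ht := (h.tendsto_const (y := z) (Ne.symm hne)).prodMk_nhds (h.tendsto_const hye)
    exact hKd _ (hKc.isClosed.mem_of_tendsto ht (Eventually.of_forall fun k => hKm (φ k))) rfl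
  subst hez
  obtain ⟨a, ψ, hψ, ha⟩ := CompactSpace.tendsto_subseq fun k => g (φ k) e
  refine ⟨fun k => g (φ (ψ k)), fun k => hg _,
    hi.comp (hφ.injective.comp hψ.injective), a, b, ?_, h.comp hψ, ha⟩
  obtain ⟨y, hy, -⟩ := exists_ne_ne e e
  obtain ⟨K, hKc, hKd, hKm⟩ := hK y hy
  have ht := ha.prodMk_nhds ((h.comp hψ).tendsto_const hy)
  exact hKd _ (hKc.isClosed.mem_of_tendsto ht (Eventually.of_forall fun k => hKm _))

theorem IsParabolicElem.exists_isConvSeq_pow (hJ : IsDiscreteConvGroup J) {g : M ≃ₜ M}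
    (hgJ : g ∈ J) (hg : IsParabolicElem g) {z : M} (hz : g z = z) :
    ∃ φ : ℕ → ℕ, StrictMono φ ∧ IsConvSeq (fun k => g ^ φ k) z z := by
  obtain ⟨φ, hφ, c, e, h⟩ := hJ (fun n : ℕ => g ^ n) (fun n => J.pow_mem hgJ n)
    (injective_pow_iff_not_isOfFinOrder.2 hg.not_isOfFinOrder)
  have huniq : ∀ x, g x = x → x = z := fun x hx => hg.2.unique hx hz
  have heq : (fun k => ((fun n : ℕ => g ^ n) ∘ φ) k * g) =
      fun k => g * ((fun n : ℕ => g ^ n) ∘ φ) k := by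
    funext k
    exact (pow_mul_comm' g (φ k))
  have h1 := h.mul_right g
  rw [heq] at h1
  have hc : c = z := huniq _ ((h.mul_left g).attracting_unique h1)
  have he : e = z := huniq _ (inv_app_eq_iff.1 (h1.repelling_unique (h.mul_left g))).symm
  subst hc
  subst he
  exact ⟨φ, hφ, h⟩

theorem IsParabolicPt.mem_limitSet (hJ : IsDiscreteConvGroup J) {z : M}
    (hz : IsParabolicPt J z) : z ∈ limitSet J := by
  obtain ⟨g, hgJ, hg, hgz⟩ := hz
  obtain ⟨φ, hφ, h⟩ := hg.exists_isConvSeq_pow hJ hgJ hgz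
  exact ⟨_, fun k => J.pow_mem hgJ _,
    (injective_pow_iff_not_isOfFinOrder.2 hg.not_isOfFinOrder).comp hφ.injective, z, h⟩

variable [SecondCountableTopology M]

theorem IsParabolicPt.not_isConicalLimitPt (hJ : IsDiscreteConvGroup J) {z : M}
    (hz : IsParabolicPt J z) : ¬IsConicalLimitPt J z := by
  intro hcon
  obtain ⟨g, hgJ, hg, hgz⟩ := hz
  obtain ⟨h, hhJ, hi, a, b, hab, hconv, ha⟩ := hcon.exists_isConvSeq hJ
  obtain ⟨η, hη, hpow⟩ := hg.exists_isConvSeq_pow hJ hgJ hgz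
  obtain ⟨y, hy, -⟩ := exists_ne_ne z z
  have hgy : g y ≠ z := fun hc => hy (g.injective (hc.trans hgz.symm))
  obtain ⟨φ, hφ, ⟨t, ht⟩ | ht⟩ :=
    exists_strictMono_const_or_injective fun n => h n * g * (h n)⁻¹
  · have happ : ∀ k x, t (h (φ k) x) = h (φ k) (g x) := by
      intro k x
      rw [← ht k]
      simp only [mul_app, inv_app]
    have hta : t a = a := by
      have h1 := (t.continuous.tendsto a).comp (ha.comp hφ.tendsto_atTop)
      refine tendsto_nhds_unique h1 ?_
      simpa [Function.comp_def, happ, hgz] using ha.comp hφ.tendsto_atTop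
    have htb : t b = b := by
      have h1 := (t.continuous.tendsto b).comp ((hconv.comp hφ).tendsto_const hy)
      refine tendsto_nhds_unique h1 ?_
      simpa [Function.comp_def, happ] using (hconv.comp hφ).tendsto_const hgy
    have hfix : ∀ x, t x = x → x = h (φ 0) z := by
      intro x hx
      have h1 := happ 0 ((h (φ 0))⁻¹ x)
      rw [app_inv, hx] at h1
      have h2 : g ((h (φ 0))⁻¹ x) = (h (φ 0))⁻¹ x := (inv_app_eq_iff.2 h1).symm
      rw [← hg.2.unique h2 hgz, app_inv]
    exact hab ((hfix a hta).trans (hfix b htb).symm)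
  · obtain ⟨ψ, hψ, c, e, htc⟩ := hJ _ (fun k => J.mul_mem (J.mul_mem (hhJ (φ k)) hgJ)
      (J.inv_mem (hhJ (φ k)))) ht
    have hφψ := hφ.comp hψ
    set H : ℕ → M ≃ₜ M := fun k => h (φ (ψ k))
    set T : ℕ → M ≃ₜ M := fun k => H k * g * (H k)⁻¹
    have htc' : IsConvSeq T c e := htc
    have happ : ∀ k x, T k (H k x) = H k (g x) := fun k x => by
      simp only [T, mul_app, inv_app]
    have hHa : Tendsto (fun k => H k z) atTop (𝓝 a) := ha.comp hφψ.tendsto_atTop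
    have hHc : IsConvSeq H b z := hconv.comp hφψ
    have hTp : ∀ n, IsConvSeq (fun k => T n ^ η k) (H n z) (H n z) := by
      intro n
      have h1 := (hpow.mul_left (H n)).mul_right (H n)⁻¹
      have h2 : (fun k => T n ^ η k) = fun k => H n * g ^ η k * (H n)⁻¹ := by
        funext k
        exact conj_pow
      rw [h2]
      simpa using h1
    have h1 : a ≠ e → a = c := by
      intro hae
      have := htc'.tendsto hHa hae
      simp only [happ, hgz] at this
      exact tendsto_nhds_unique hHa this
    have h2 : b ≠ e → b = c := by
      intro hbe
      have := htc'.tendsto (hHc.tendsto_const hy) hbe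
      simp only [happ] at this
      exact tendsto_nhds_unique (hHc.tendsto_const hgy) this
    by_cases hae : a = e
    · subst hae
      obtain rfl := h2 hab.symm
      exact false_of_isConvSeq_of_pow htc' hab hHa
        fun n => ⟨_, fun k => ⟨η k, rfl⟩, hTp n⟩
    · obtain rfl := h1 hae
      have hbe : b = e := by
        by_contra hbe
        exact hab (h2 hbe).symm
      subst hbe
      refine false_of_isConvSeq_of_pow htc'.inv hab hHa
        fun n => ⟨_, fun k => ⟨η k, ?_⟩, (hTp n).inv⟩
      rw [inv_pow]

end Conical

section Separators

/-- A weighted family of pairs `(N i, V i)` of sets that do not cover the space. -/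
structure Separators (M ι : Type*) where
  N : ι → Set M
  V : ι → Set M
  wt : ι → ENNReal
  gap : ∀ i, ∃ x, x ∉ N i ∧ x ∉ V i
  le_one : ∀ i, wt i ≤ 1

namespace Separators

variable {ι : Type*} (P : Separators M ι)

/-- The translate `h (N i)`, for `A = (h, i)`. -/
def neg (A : (M ≃ₜ M) × ι) : Set M := {x | A.1⁻¹ x ∈ P.N A.2}

/-- The translate `h (V i)`, for `A = (h, i)`. -/
def pos (A : (M ≃ₜ M) × ι) : Set M := {x | A.1⁻¹ x ∈ P.V A.2}

/-- Nestedness of translated separators. -/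
def Nested (A B : (M ≃ₜ M) × ι) : Prop := ∀ x, x ∉ P.pos A → x ∈ P.neg B

/-- A finite nested collection of `J`-translates of separators, all separating `q` from `w`. -/
def IsChainFrom (J : Subgroup (M ≃ₜ M)) (q w : M) (S : Finset ((M ≃ₜ M) × ι)) : Prop :=
  (∀ A ∈ S, A.1 ∈ J ∧ q ∈ P.neg A ∧ w ∈ P.pos A) ∧
    ∀ A ∈ S, ∀ B ∈ S, A ≠ B → P.Nested A B ∨ P.Nested B A

/-- The total weight of a finite collection of translated separators. -/
noncomputable def weight (S : Finset ((M ≃ₜ M) × ι)) : ENNReal := ∑ A ∈ S, P.wt A.2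

/-- The largest weight of a nested collection of separators between `q` and `w`. -/
noncomputable def height (J : Subgroup (M ≃ₜ M)) (q w : M) : ENNReal :=
  ⨆ S : {S // P.IsChainFrom J q w S}, P.weight S.1

/-- The translates `(h, i)` with `q ∈ h (N i)` such that `h (V i)` meets both `C` and `D`. -/
def crossing (J : Subgroup (M ≃ₜ M)) (q : M) (C D : Set M) : Set ((M ≃ₜ M) × ι) :=
  {A | A.1 ∈ J ∧ q ∈ P.neg A ∧ (∃ x ∈ P.pos A, x ∈ C) ∧ ∃ x ∈ P.pos A, x ∈ D}

/-- The total weight of `crossing`. -/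
noncomputable def crossingWeight (J : Subgroup (M ≃ₜ M)) (q : M) (C D : Set M) : ENNReal :=
  ∑' A, (P.crossing J q C D).indicator (fun A => P.wt A.2) A

variable {P} {J : Subgroup (M ≃ₜ M)} {q w : M}

theorem not_nested_self (A : (M ≃ₜ M) × ι) : ¬P.Nested A A := by
  intro h
  obtain ⟨x, hN, hV⟩ := P.gap A.2
  refine hN ?_
  have := h (A.1 x) (by simpa [pos, inv_app] using hV)
  simpa [neg, inv_app] using this

theorem nested_translate {A B : (M ≃ₜ M) × ι} (g : M ≃ₜ M) (h : P.Nested A B) :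
    P.Nested (g * A.1, A.2) (g * B.1, B.2) := fun x hx => by
  have := h (g⁻¹ x) (by simpa [pos, mul_app] using hx)
  simpa [neg, mul_app] using this

theorem weight_le_crossingWeight {S : Finset ((M ≃ₜ M) × ι)} {C D : Set M}
    (hS : ∀ A ∈ S, A ∈ P.crossing J q C D) : P.weight S ≤ P.crossingWeight J q C D := by
  refine le_trans (le_of_eq ?_) (ENNReal.sum_le_tsum S)
  exact Finset.sum_congr rfl fun A hA => (indicator_of_mem (hS A hA) (fun A => P.wt A.2)).symm

theorem IsChainFrom.weight_le_height {S : Finset ((M ≃ₜ M) × ι)} (hS : P.IsChainFrom J q w S) :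
    P.weight S ≤ P.height J q w :=
  le_iSup (fun S : {S // P.IsChainFrom J q w S} => P.weight S.1) ⟨S, hS⟩

theorem height_le_crossingWeight : P.height J q w ≤ P.crossingWeight J q {w} {w} :=
  iSup_le fun S => weight_le_crossingWeight fun A hA =>
    ⟨(S.2.1 A hA).1, (S.2.1 A hA).2.1, ⟨w, (S.2.1 A hA).2.2, rfl⟩, w, (S.2.1 A hA).2.2, rfl⟩

theorem isChainFrom_translate_union [DecidableEq ((M ≃ₜ M) × ι)] {g : M ≃ₜ M} (hg : g ∈ J)
    {D : Set M} {S T : Finset ((M ≃ₜ M) × ι)} (hS : P.IsChainFrom J q (g w) S)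
    (hSD : ∀ A ∈ S, ∀ x ∈ D, x ∈ P.neg A) (hT : P.IsChainFrom J q w T) (hgq : g q ∈ D)
    (hTD : ∀ B ∈ T, ∀ x, x ∉ P.pos B → g x ∈ D) :
    P.IsChainFrom J q w (T ∪ S.image fun A => (g⁻¹ * A.1, A.2)) ∧
      Disjoint T (S.image fun A => (g⁻¹ * A.1, A.2)) := by
  have hmix : ∀ B ∈ T, ∀ A ∈ S, P.Nested B (g⁻¹ * A.1, A.2) := by
    intro B hB A hA x hx
    have := hSD A hA _ (hTD B hB x hx)
    simpa [neg, mul_app] using this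
  refine ⟨⟨fun A hA => ?_, fun A hA B hB hAB => ?_⟩, ?_⟩
  · rcases Finset.mem_union.1 hA with hA | hA
    · exact hT.1 A hA
    · obtain ⟨A', hA', rfl⟩ := Finset.mem_image.1 hA
      refine ⟨J.mul_mem (J.inv_mem hg) (hS.1 A' hA').1, ?_, ?_⟩
      · have := hSD A' hA' _ hgq
        simpa [neg, mul_app] using this
      · have := (hS.1 A' hA').2.2
        simpa [pos, mul_app] using this
  · rcases Finset.mem_union.1 hA with hA | hA <;> rcases Finset.mem_union.1 hB with hB | hB
    · exact hT.2 A hA B hB hAB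
    · obtain ⟨B', hB', rfl⟩ := Finset.mem_image.1 hB
      exact Or.inl (hmix A hA B' hB')
    · obtain ⟨A', hA', rfl⟩ := Finset.mem_image.1 hA
      exact Or.inr (hmix B hB A' hA')
    · obtain ⟨A', hA', rfl⟩ := Finset.mem_image.1 hA
      obtain ⟨B', hB', rfl⟩ := Finset.mem_image.1 hB
      have hne : A' ≠ B' := fun h => hAB (by rw [h])
      exact (hS.2 A' hA' B' hB' hne).imp (nested_translate _) (nested_translate _)
  · rw [Finset.disjoint_left]
    intro B hB hB'
    obtain ⟨A, hA, rfl⟩ := Finset.mem_image.1 hB'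
    exact not_nested_self _ (hmix _ hB A hA)

theorem weight_add_height_le {g : M ≃ₜ M} (hg : g ∈ J) {C D : Set M} (hgw : g w ∈ C)
    (hgq : g q ∈ D) {T : Finset ((M ≃ₜ M) × ι)} (hT : P.IsChainFrom J q w T)
    (hTD : ∀ B ∈ T, ∀ x, x ∉ P.pos B → g x ∈ D) :
    P.weight T + P.height J q (g w) ≤ P.height J q w + (P.crossingWeight J q C D + 1) := by
  classical
  have : Nonempty {S // P.IsChainFrom J q (g w) S} := ⟨⟨∅, by simp [IsChainFrom]⟩⟩
  rw [height, ENNReal.add_iSup]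
  refine iSup_le fun ⟨S, hS⟩ => ?_
  set S₁ := S.filter fun A => A ∈ P.crossing J q C D
  set S₂ := (S.filter fun A => A ∉ P.crossing J q C D).filter fun A => ∀ x ∈ D, x ∈ P.neg A
  set S₃ := (S.filter fun A => A ∉ P.crossing J q C D).filter fun A => ¬∀ x ∈ D, x ∈ P.neg A
  have hsplit : P.weight S = P.weight S₁ + (P.weight S₂ + P.weight S₃) := by
    simp only [weight, S₁, S₂, S₃]
    rw [Finset.sum_filter_add_sum_filter_not, Finset.sum_filter_add_sum_filter_not]
  have h1 : P.weight S₁ ≤ P.crossingWeight J q C D :=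
    weight_le_crossingWeight fun A hA => (Finset.mem_filter.1 hA).2
  have h2 : P.weight T + P.weight S₂ ≤ P.height J q w := by
    have hS₂ : ∀ A ∈ S₂, A ∈ S ∧ ∀ x ∈ D, x ∈ P.neg A := fun A hA =>
      ⟨(Finset.mem_filter.1 (Finset.mem_filter.1 hA).1).1, (Finset.mem_filter.1 hA).2⟩
    obtain ⟨hch, hdj⟩ := isChainFrom_translate_union (P := P) (S := S₂) hg
      ⟨fun A hA => hS.1 A (hS₂ A hA).1, fun A hA B hB => hS.2 A (hS₂ A hA).1 B (hS₂ B hB).1⟩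
      (fun A hA => (hS₂ A hA).2) hT hgq hTD
    refine le_trans (le_of_eq ?_) hch.weight_le_height
    simp only [weight]
    rw [Finset.sum_union hdj, Finset.sum_image]
    intro A _ B _ hAB
    simp only [Prod.mk.injEq, mul_right_inj] at hAB
    exact Prod.ext hAB.1 hAB.2
  have h3 : P.weight S₃ ≤ 1 := by
    have hgood : ∀ A ∈ S₃, A ∈ S ∧ (∀ x ∈ D, x ∉ P.pos A) ∧ ¬∀ x ∈ D, x ∈ P.neg A := by
      intro A hA
      obtain ⟨hA1, hA2⟩ := Finset.mem_filter.1 hA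
      obtain ⟨hA1, hA3⟩ := Finset.mem_filter.1 hA1
      have := hS.1 A hA1
      refine ⟨hA1, fun x hxD hx => hA3 ⟨this.1, this.2.1, ⟨_, this.2.2, hgw⟩, x, hx, hxD⟩, hA2⟩
    have hcard : ∀ A ∈ S₃, ∀ B ∈ S₃, A = B := by
      intro A hA B hB
      obtain ⟨hA, hA1, hA2⟩ := hgood A hA
      obtain ⟨hB, hB1, hB2⟩ := hgood B hB
      by_contra hne
      rcases hS.2 A hA B hB hne with h | h
      · exact hB2 fun x hx => h x (hA1 x hx)
      · exact hA2 fun x hx => h x (hB1 x hx)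
    rcases S₃.eq_empty_or_nonempty with h | ⟨A, hA⟩
    · rw [h]
      simp [weight]
    · have : S₃ = {A} := Finset.eq_singleton_iff_unique_mem.2 ⟨hA, fun B hB => hcard B hB A hA⟩
      rw [this]
      simpa [weight] using P.le_one A.2
  calc P.weight T + P.weight S
      = (P.weight T + P.weight S₂) + (P.weight S₁ + P.weight S₃) := by rw [hsplit]; ring
    _ ≤ _ := add_le_add h2 (add_le_add h1 h3)

/-- Every `J`-orbit contains a point that is almost closest to `q`. -/
theorem exists_almost_minimal (w : M)
    (hfin : ∀ g ∈ J, P.crossingWeight J q {g w} {g w} ≠ ⊤) :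
    ∃ j ∈ J, ∀ g ∈ J, ∀ C D : Set M, g (j w) ∈ C → g q ∈ D →
      ∀ T, P.IsChainFrom J q (j w) T → (∀ B ∈ T, ∀ x, x ∉ P.pos B → g x ∈ D) →
        P.weight T ≤ P.crossingWeight J q C D + 2 := by
  have hh : ∀ g ∈ J, P.height J q (g w) ≠ ⊤ := fun g hg =>
    ne_top_of_le_ne_top (hfin g hg) height_le_crossingWeight
  set m := ⨅ g : J, P.height J q (g.1 w)
  have hm : m ≠ ⊤ := ne_top_of_le_ne_top (hh 1 J.one_mem) (iInf_le _ (1 : J))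
  obtain ⟨⟨j, hj⟩, hlt⟩ := iInf_lt_iff.1 (ENNReal.lt_add_right hm one_ne_zero)
  refine ⟨j, hj, fun g hg C D hC hD T hT hTD => ?_⟩
  have h1 := weight_add_height_le hg hC hD hT hTD
  have h2 : m ≤ P.height J q (g (j w)) := iInf_le (fun g : J => P.height J q (g.1 w))
    ⟨g * j, J.mul_mem hg hj⟩
  have h3 : P.height J q (g (j w)) ≠ ⊤ := hh (g * j) (J.mul_mem hg hj)
  have h4 : P.weight T + P.height J q (g (j w)) ≤
      P.crossingWeight J q C D + 2 + P.height J q (g (j w)) := by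
    calc _ ≤ P.height J q (j w) + (P.crossingWeight J q C D + 1) := h1
      _ ≤ (P.height J q (g (j w)) + 1) + (P.crossingWeight J q C D + 1) := by
        gcongr
        exact hlt.le.trans (by gcongr)
      _ = _ := by ring
  exact (ENNReal.add_le_add_iff_right h3).1 h4

end Separators

end Separators

section Weights

theorem tsum_ne_top_of_le_geometric {ι : Type*} {e : ι → ℕ} (he : Function.Injective e)
    {c : ι → ENNReal} (hc : ∀ i, c i ≠ ⊤) {m : ℕ} (h : ∀ i, m ≤ e i → c i ≤ 2⁻¹ ^ e i) :
    ∑' i, c i ≠ ⊤ := by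
  set s : Set ι := {i | e i < m}
  have hs : s.Finite := Set.Finite.preimage he.injOn (Set.finite_lt_nat m)
  have hle : ∀ i, c i ≤ s.indicator c i + 2⁻¹ ^ e i := by
    intro i
    by_cases hi : i ∈ s
    · rw [indicator_of_mem hi]
      exact le_self_add
    · exact (h i (not_lt.1 hi)).trans le_add_self
  refine ne_top_of_le_ne_top ?_ (ENNReal.tsum_le_tsum hle)
  rw [ENNReal.tsum_add]
  refine ENNReal.add_ne_top.2 ⟨?_, ?_⟩
  · rw [tsum_eq_sum (s := hs.toFinset) (fun i hi => indicator_of_notMem (by simpa using hi) _)]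
    refine ENNReal.sum_ne_top.2 fun i _ => ?_
    by_cases hi : i ∈ s
    · rw [indicator_of_mem hi]
      exact hc i
    · rw [indicator_of_notMem hi]
      exact ENNReal.zero_ne_top
  · refine ne_top_of_le_ne_top ?_
      (ENNReal.tsum_comp_le_tsum_of_injective he fun n : ℕ => (2⁻¹ : ENNReal) ^ n)
    rw [ENNReal.tsum_geometric]
    simp

theorem Separators.crossingWeight_ne_top {ι : Type*} (P : Separators M ι)
    {J : Subgroup (M ≃ₜ M)} {q : M} {C D : Set M} {e : ι → ℕ} (he : Function.Injective e)
    {F : ι → Set (M ≃ₜ M)} (hF : ∀ i, F i = {h | h ∈ J ∧ h⁻¹ q ∈ P.N i ∧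
      (∃ v ∈ P.V i, h v ∈ C) ∧ ∃ v ∈ P.V i, h v ∈ D})
    (hfin : ∀ i, (F i).Finite) {m : ℕ}
    (hm : ∀ i, m ≤ e i → (F i).ncard * P.wt i ≤ 2⁻¹ ^ e i) :
    P.crossingWeight J q C D ≠ ⊤ := by
  have hmem : ∀ h i, (h, i) ∈ P.crossing J q C D ↔ h ∈ F i := by
    intro h i
    rw [hF]
    have hx : ∀ E : Set M, (∃ x ∈ P.pos (h, i), x ∈ E) ↔ ∃ v ∈ P.V i, h v ∈ E := by
      intro E
      constructor
      · rintro ⟨x, hx, hE⟩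
        exact ⟨h⁻¹ x, hx, by rwa [app_inv]⟩
      · rintro ⟨v, hv, hE⟩
        exact ⟨h v, by simpa [Separators.pos, inv_app] using hv, hE⟩
    simp only [Separators.crossing, Set.mem_ofPred_eq, hx]
    rfl
  have hsum : P.crossingWeight J q C D = ∑' i, (F i).ncard * P.wt i := by
    have hprod : P.crossingWeight J q C D =
        ∑' (h) (i), (P.crossing J q C D).indicator (fun A => P.wt A.2) (h, i) :=
      ENNReal.tsum_prod (f := fun h i =>
        (P.crossing J q C D).indicator (fun A => P.wt A.2) (h, i))
    rw [hprod, ENNReal.tsum_comm]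
    refine tsum_congr fun i => ?_
    rw [tsum_eq_sum (s := (hfin i).toFinset) (fun h hh =>
      indicator_of_notMem (by rw [hmem]; simpa using hh) _)]
    have hconst : ∀ h ∈ (hfin i).toFinset,
        (P.crossing J q C D).indicator (fun A => P.wt A.2) (h, i) = P.wt i := fun h hh =>
      indicator_of_mem ((hmem h i).2 ((hfin i).mem_toFinset.1 hh)) (fun A => P.wt A.2)
    rw [Finset.sum_congr rfl hconst, Finset.sum_const, nsmul_eq_mul,
      Set.ncard_eq_toFinset_card _ (hfin i)]
  rw [hsum]
  refine tsum_ne_top_of_le_geometric he (fun i => ?_) hm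
  exact ENNReal.mul_ne_top (ENNReal.natCast_ne_top _)
    (ne_top_of_le_ne_top ENNReal.one_ne_top (P.le_one i))

end Weights

section Shrinking

variable [CompactSpace M] [T2Space M] {J : Subgroup (M ≃ₜ M)}

theorem exists_ne_of_mem_nhds {q z : M} (hq : q ∉ limitSet J) (hz : z ∈ limitSet J)
    {U : Set M} (hU : U ∈ 𝓝 z) : ∃ x ∈ U, x ≠ z := by
  obtain ⟨g, hg, hi, zm, h⟩ := hz
  have hzm := h.repelling_mem_limitSet hg hi
  obtain ⟨k, hk⟩ := ((h.tendsto_const (y := q) fun hc => hq (hc ▸ hzm)).eventually hU).exists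
  refine ⟨_, hk, fun hc => hq ?_⟩
  rw [← app_mem_limitSet_iff (hg k), hc]
  exact ⟨g, hg, hi, zm, h⟩

theorem exists_shrinking (hJ : IsDiscreteConvGroup J) {q z : M} (hq : q ∉ limitSet J)
    (hz : z ∈ limitSet J) {C D : ℕ → Set M} (hC : ∀ l, IsClosed (C l))
    (hD : ∀ l, IsClosed (D l)) (hCD : ∀ l, ∀ x ∈ C l, x ∈ D l → x ∉ limitSet J) (m : ℕ)
    {U : Set M} (hU : IsOpen U) (hzU : z ∈ U) :
    ∃ U', IsOpen U' ∧ z ∈ U' ∧ closure U' ⊆ U ∧ (∃ x ∈ U, x ∉ closure U') ∧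
      ∀ l ≤ m, ∀ h ∈ J, h⁻¹ q ∉ U → (∃ v ∈ closure U', h v ∈ C l) →
        ¬∃ v ∈ closure U', h v ∈ D l := by
  obtain ⟨t, htz, htc, htU⟩ := exists_mem_nhds_isClosed_subset (hU.mem_nhds hzU)
  obtain ⟨x, hxU, hxz⟩ := exists_ne_of_mem_nhds hq hz (hU.mem_nhds hzU)
  have hfin : ∀ l, {h | h ∈ J ∧ h⁻¹ q ∈ Uᶜ ∧ (∃ v ∈ t, h v ∈ C l) ∧ ∃ v ∈ t, h v ∈ D l}.Finite :=
    fun l => finite_separating hJ hU.isClosed_compl htc (hC l) (hD l)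
      (disjoint_compl_left_iff_subset.2 htU) (hCD l) hq
  have hloc : ∀ l, ∀ h ∈ J, ∀ᶠ V in (𝓝 z).smallSets,
      ¬((∃ v ∈ V, h v ∈ C l) ∧ ∃ v ∈ V, h v ∈ D l) := by
    intro l h hh
    have hhz := app_mem_limitSet hh hz
    rw [eventually_smallSets]
    by_cases hc : h z ∈ C l
    · refine ⟨h ⁻¹' (D l)ᶜ, h.continuous.continuousAt.preimage_mem_nhds
        ((hD l).isOpen_compl.mem_nhds fun hd => hCD l _ hc hd hhz), ?_⟩
      rintro V hV ⟨-, v, hv, hvD⟩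
      exact hV hv hvD
    · refine ⟨h ⁻¹' (C l)ᶜ, h.continuous.continuousAt.preimage_mem_nhds
        ((hC l).isOpen_compl.mem_nhds hc), ?_⟩
      rintro V hV ⟨⟨v, hv, hvC⟩, -⟩
      exact hV hv hvC
  have hall : ∀ᶠ V in (𝓝 z).smallSets, ∀ l ∈ Set.Iic m,
      ∀ h ∈ {h | h ∈ J ∧ h⁻¹ q ∈ Uᶜ ∧ (∃ v ∈ t, h v ∈ C l) ∧ ∃ v ∈ t, h v ∈ D l},
        ¬((∃ v ∈ V, h v ∈ C l) ∧ ∃ v ∈ V, h v ∈ D l) := by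
    rw [eventually_all_finite (Set.finite_Iic m)]
    intro l _
    rw [eventually_all_finite (hfin l)]
    exact fun h hh => hloc l h hh.1
  obtain ⟨s, hs, hsV⟩ := eventually_smallSets.1 hall
  obtain ⟨t', ht'z, ht'c, ht's⟩ := exists_mem_nhds_isClosed_subset
    (inter_mem (inter_mem htz hs) (isOpen_compl_singleton.mem_nhds (Ne.symm hxz)))
  have hcl : closure (interior t') ⊆ t' := closure_minimal interior_subset ht'c
  refine ⟨interior t', isOpen_interior, mem_interior_iff_mem_nhds.2 ht'z,
    fun y hy => htU (ht's (hcl hy)).1.1, ⟨x, hxU, fun hx => (ht's (hcl hx)).2 rfl⟩, ?_⟩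
  rintro l hl h hh hhq ⟨v, hv, hvC⟩ ⟨v', hv', hvD⟩
  exact hsV (closure (interior t')) (fun y hy => (ht's (hcl hy)).1.2) l hl h
    ⟨hh, hhq, ⟨v, (ht's (hcl hv)).1.1, hvC⟩, v', (ht's (hcl hv')).1.1, hvD⟩
    ⟨⟨v, hv, hvC⟩, v', hv', hvD⟩

theorem exists_shrinking_seq (hJ : IsDiscreteConvGroup J) {q z : M} (hq : q ∉ limitSet J)
    (hz : z ∈ limitSet J) {C D : ℕ → Set M} (hC : ∀ l, IsClosed (C l))
    (hD : ∀ l, IsClosed (D l)) (hCD : ∀ l, ∀ x ∈ C l, x ∈ D l → x ∉ limitSet J) (m : ℕ → ℕ) :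
    ∃ U : ℕ → Set M, ∀ n, IsOpen (U n) ∧ z ∈ U n ∧ q ∉ U n ∧ closure (U (n + 1)) ⊆ U n ∧
      (∃ x ∈ U n, x ∉ closure (U (n + 1))) ∧
      ∀ l ≤ m n, ∀ h ∈ J, h⁻¹ q ∉ U n → (∃ v ∈ closure (U (n + 1)), h v ∈ C l) →
        ¬∃ v ∈ closure (U (n + 1)), h v ∈ D l := by
  have hstep : ∀ (n : ℕ) (U : {U : Set M // IsOpen U ∧ z ∈ U ∧ q ∉ U}),
      ∃ U' : {U : Set M // IsOpen U ∧ z ∈ U ∧ q ∉ U}, closure U'.1 ⊆ U.1 ∧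
        (∃ x ∈ U.1, x ∉ closure U'.1) ∧
        ∀ l ≤ m n, ∀ h ∈ J, h⁻¹ q ∉ U.1 → (∃ v ∈ closure U'.1, h v ∈ C l) →
          ¬∃ v ∈ closure U'.1, h v ∈ D l := by
    rintro n ⟨U, hU, hzU, hqU⟩
    obtain ⟨U', h1, h2, h3, h4, h5⟩ := exists_shrinking hJ hq hz hC hD hCD (m n) hU hzU
    exact ⟨⟨U', h1, h2, fun hc => hqU (h3 (subset_closure hc))⟩, h3, h4, h5⟩
  choose step hs using hstep
  let W : ℕ → {U : Set M // IsOpen U ∧ z ∈ U ∧ q ∉ U} := fun n =>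
    Nat.rec ⟨{q}ᶜ, isOpen_compl_singleton, fun hc => hq (hc ▸ hz), fun hc => hc rfl⟩ step n
  exact ⟨fun n => (W n).1, fun n => ⟨(W n).2.1, (W n).2.2.1, (W n).2.2.2, hs n (W n)⟩⟩

theorem countable_parabolicPts [SecondCountableTopology M] (hJ : IsDiscreteConvGroup J) {q : M}
    (hq : q ∉ limitSet J) : {z | IsParabolicPt J z}.Countable := by
  have hc := countable_of_notMem_limitSet hJ hq
  choose! g hgJ hg hgz using fun z (hz : IsParabolicPt J z) => hz
  refine Set.MapsTo.countable_of_injOn (f := g) (fun z hz => hgJ z hz) ?_ hc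
  intro z hz z' hz' hzz
  exact (hg z hz).2.unique (hgz z hz) (by rw [hzz]; exact hgz z' hz')

end Shrinking

section Dirichlet

theorem exists_separators.{u} {M : Type u} [TopologicalSpace M] [CompactSpace M] [T2Space M]
    [Infinite M] [SecondCountableTopology M] {J : Subgroup (M ≃ₜ M)}
    (hJ : IsDiscreteConvGroup J) {q : M} (hq : q ∉ limitSet J)
    {C D : ℕ → Set M} (hC : ∀ l, IsClosed (C l)) (hD : ∀ l, IsClosed (D l))
    (hCD : ∀ l, ∀ x ∈ C l, x ∈ D l → x ∉ limitSet J) :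
    ∃ (ι : Type u) (P : Separators M ι), (∀ m, P.crossingWeight J q (C m) (D m) ≠ ⊤) ∧
      (∀ O₁ ∈ TopologicalSpace.countableBasis M, ∀ O₂ ∈ TopologicalSpace.countableBasis M,
        Disjoint (closure O₂) (closure O₁) → (∃ x, x ∉ closure O₂ ∧ x ∉ closure O₁) →
        ∃ i, P.N i = closure O₂ ∧ P.V i = closure O₁ ∧ P.wt i ≠ 0) ∧
      ∀ z, IsParabolicPt J z → ∃ U : ℕ → Set M,
        (∀ n, IsOpen (U n) ∧ z ∈ U n ∧ q ∉ U n ∧ closure (U (n + 1)) ⊆ U n) ∧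
        ∀ n, ∃ i, P.N i = (U n)ᶜ ∧ P.V i = closure (U (n + 1)) ∧ P.wt i = 1 := by
  set b := TopologicalSpace.countableBasis M
  set I : Set (Set M × Set M) := {p | (p.1 ∈ b ∧ p.2 ∈ b) ∧
    Disjoint (closure p.2) (closure p.1) ∧ ∃ x, x ∉ closure p.2 ∧ x ∉ closure p.1}
  have hI : I.Countable := (((TopologicalSpace.countable_countableBasis M).prod
    (TopologicalSpace.countable_countableBasis M))).mono fun p hp => hp.1
  have : Countable I := hI.to_subtype
  have : Countable {z | IsParabolicPt J z} := (countable_parabolicPts hJ hq).to_subtype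
  obtain ⟨e, he⟩ := exists_injective_nat (I ⊕ ({z | IsParabolicPt J z} × ℕ))
  choose U hU using fun z : {z | IsParabolicPt J z} =>
    exists_shrinking_seq hJ hq (IsParabolicPt.mem_limitSet hJ z.2) hC hD hCD
      fun n => e (Sum.inr (z, n))
  let N : I ⊕ ({z | IsParabolicPt J z} × ℕ) → Set M :=
    Sum.elim (fun p => closure p.1.2) fun p => (U p.1 p.2)ᶜ
  let V : I ⊕ ({z | IsParabolicPt J z} × ℕ) → Set M :=
    Sum.elim (fun p => closure p.1.1) fun p => closure (U p.1 (p.2 + 1))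
  let F : ℕ → I ⊕ ({z | IsParabolicPt J z} × ℕ) → Set (M ≃ₜ M) := fun m i =>
    {h | h ∈ J ∧ h⁻¹ q ∈ N i ∧ (∃ v ∈ V i, h v ∈ C m) ∧ ∃ v ∈ V i, h v ∈ D m}
  let d : I → ENNReal := fun p =>
    1 + ∑ m ∈ Finset.range (e (Sum.inl p) + 1), ((F m (Sum.inl p)).ncard : ENNReal)
  have hNc : ∀ i, IsClosed (N i) := by
    rintro (p | p)
    · exact isClosed_closure
    · exact (hU p.1 p.2).1.isClosed_compl
  have hVc : ∀ i, IsClosed (V i) := by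
    rintro (p | p) <;> exact isClosed_closure
  have hNV : ∀ i, Disjoint (N i) (V i) := by
    rintro (p | p)
    · exact p.2.2.1
    · exact disjoint_compl_left_iff_subset.2 (hU p.1 p.2).2.2.2.1
  have hd1 : ∀ p, 1 ≤ d p := fun p => le_self_add
  have hdt : ∀ p, d p ≠ ⊤ := fun p => ENNReal.add_ne_top.2
    ⟨ENNReal.one_ne_top, ENNReal.sum_ne_top.2 fun _ _ => ENNReal.natCast_ne_top _⟩
  let P : Separators M (I ⊕ ({z | IsParabolicPt J z} × ℕ)) :=
    { N := N
      V := V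
      wt := Sum.elim (fun p => 2⁻¹ ^ e (Sum.inl p) / d p) fun _ => 1
      gap := by
        rintro (p | p)
        · exact p.2.2.2
        · obtain ⟨x, hx, hx'⟩ := (hU p.1 p.2).2.2.2.2.1
          exact ⟨x, not_not.2 hx, hx'⟩
      le_one := by
        rintro (p | p)
        · refine ENNReal.div_le_of_le_mul ?_
          rw [one_mul]
          exact (pow_le_one₀ zero_le (by simp)).trans (hd1 p)
        · exact le_rfl }
  refine ⟨_, P, fun m => ?_, fun O₁ hO₁ O₂ hO₂ hdis hgap => ?_, fun z hz => ?_⟩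
  · refine P.crossingWeight_ne_top he (F := F m) (m := m) (fun i => rfl)
      (fun i => finite_separating hJ (hNc i) (hVc i) (hC m) (hD m) (hNV i) (hCD m) hq) ?_
    rintro (p | p) hm
    · have hle : ((F m (Sum.inl p)).ncard : ENNReal) ≤ d p :=
        (Finset.single_le_sum (f := fun m => ((F m (Sum.inl p)).ncard : ENNReal))
          (fun _ _ => zero_le) (Finset.mem_range.2 (Nat.lt_succ_of_le hm))).trans le_add_self
      calc ((F m (Sum.inl p)).ncard : ENNReal) * (2⁻¹ ^ e (Sum.inl p) / d p)
          ≤ d p * (2⁻¹ ^ e (Sum.inl p) / d p) := by gcongr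
        _ = 2⁻¹ ^ e (Sum.inl p) := ENNReal.mul_div_cancel
          (one_pos.trans_le (hd1 p)).ne' (hdt p)
    · have hemp : F m (Sum.inr p) = ∅ := by
        refine eq_empty_of_forall_notMem fun h hh => ?_
        exact (hU p.1 p.2).2.2.2.2.2 m hm h hh.1 hh.2.1 hh.2.2.1 hh.2.2.2
      rw [hemp]
      simp
  · refine ⟨Sum.inl ⟨(O₁, O₂), ⟨hO₁, hO₂⟩, hdis, hgap⟩, rfl, rfl, ?_⟩
    exact (ENNReal.div_pos (pow_ne_zero _ (by simp)) (hdt _)).ne'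
  · refine ⟨U ⟨z, hz⟩, fun n => ?_, fun n => ⟨Sum.inr (⟨z, hz⟩, n), rfl, rfl, rfl⟩⟩
    exact ⟨(hU ⟨z, hz⟩ n).1, (hU ⟨z, hz⟩ n).2.1, (hU ⟨z, hz⟩ n).2.2.1, (hU ⟨z, hz⟩ n).2.2.2.1⟩

variable [CompactSpace M] [T2Space M] [SecondCountableTopology M] {J : Subgroup (M ≃ₜ M)}

theorem exists_basis_nhds {z : M} {U : Set M} (hU : U ∈ 𝓝 z) :
    ∃ O ∈ TopologicalSpace.countableBasis M, z ∈ O ∧ closure O ⊆ U := by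
  obtain ⟨t, htz, htc, htU⟩ := exists_mem_nhds_isClosed_subset hU
  obtain ⟨O, hO, hzO, hOt⟩ :=
    (TopologicalSpace.isBasis_countableBasis M).mem_nhds_iff.1 htz
  exact ⟨O, hO, hzO, (closure_minimal hOt htc).trans htU⟩

/-- The constraint on separators that bounds the weight of a nested collection between `q` and
a point `v`. -/
def Separators.BoundedAt {ι : Type*} (P : Separators M ι) (J : Subgroup (M ≃ₜ M)) (q v : M) :
    Prop :=
  ∀ g ∈ J, ∀ C D : Set M, g v ∈ C → g q ∈ D → ∀ T, P.IsChainFrom J q v T →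
    (∀ B ∈ T, ∀ x, x ∉ P.pos B → g x ∈ D) → P.weight T ≤ P.crossingWeight J q C D + 2

theorem false_of_boundedAt_parabolic {ι : Type*} (P : Separators M ι) {q : M}
    (htest : ∀ O₁ ∈ TopologicalSpace.countableBasis M, ∀ O₃ ∈ TopologicalSpace.countableBasis M,
      closure O₃ ⊆ O₁ → P.crossingWeight J q (closure O₃) O₁ᶜ ≠ ⊤)
    {v : ℕ → M} (hv : ∀ k, P.BoundedAt J q (v k)) {z : M} {U : ℕ → Set M}
    (hU : ∀ n, IsOpen (U n) ∧ z ∈ U n ∧ q ∉ U n ∧ closure (U (n + 1)) ⊆ U n)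
    (hUi : ∀ n, ∃ i, P.N i = (U n)ᶜ ∧ P.V i = closure (U (n + 1)) ∧ P.wt i = 1)
    (hvz : Tendsto v atTop (𝓝 z)) {π : ℕ → M ≃ₜ M} (hπ : ∀ k, π k ∈ J) (hc : IsConvSeq π z z)
    {κ : M} (hκ : κ ≠ z) (hπv : Tendsto (fun k => π k (v k)) atTop (𝓝 κ)) : False := by
  classical
  choose i hN hV hwt using hUi
  have hanti : Antitone U :=
    antitone_nat_of_succ_le fun n => subset_closure.trans (hU n).2.2.2
  obtain ⟨O₁, hO₁, hκO₁, hO₁z⟩ := exists_basis_nhds (isOpen_compl_singleton.mem_nhds hκ)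
  have hO₁o := TopologicalSpace.isOpen_of_mem_countableBasis hO₁
  obtain ⟨O₃, hO₃, hκO₃, hO₃O₁⟩ := exists_basis_nhds (hO₁o.mem_nhds hκO₁)
  have hO₃o := TopologicalSpace.isOpen_of_mem_countableBasis hO₃
  have hL := htest O₁ hO₁ O₃ hO₃ hO₃O₁
  have hzO₁ : O₁ᶜ ∈ 𝓝 z := mem_of_superset
    (isClosed_closure.isOpen_compl.mem_nhds fun h => hO₁z h rfl)
    (compl_subset_compl.2 subset_closure)
  let A : ℕ → (M ≃ₜ M) × ι := fun n => (1, i n)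
  have hneg : ∀ n x, x ∈ P.neg (A n) ↔ x ∉ U n := fun n x => by
    simp only [Separators.neg, A, hN, inv_one]
    rfl
  have hpos : ∀ n x, x ∈ P.pos (A n) ↔ x ∈ closure (U (n + 1)) := fun n x => by
    simp only [Separators.pos, A, hV, inv_one]
    rfl
  have hnest : ∀ m n, m < n → P.Nested (A m) (A n) := by
    intro m n hmn x hx
    rw [hpos] at hx
    rw [hneg]
    exact fun hc => hx (subset_closure (hanti hmn hc))
  have hA : Function.Injective A := by
    intro m n hmn
    rcases lt_trichotomy m n with h | h | h
    · exact (Separators.not_nested_self _ (hmn ▸ hnest m n h)).elim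
    · exact h
    · exact (Separators.not_nested_self _ (hmn ▸ hnest n m h)).elim
  have hbound : ∀ R : ℕ, (R : ENNReal) ≤ P.crossingWeight J q (closure O₃) O₁ᶜ + 2 := by
    intro R
    obtain ⟨k, hk, hkv, hkκ⟩ := ((hc.eventually_of_nhds hzO₁ ((hU R).1.mem_nhds (hU R).2.1)).and
      ((hvz.eventually ((hU R).1.mem_nhds (hU R).2.1)).and
        (hπv.eventually (hO₃o.mem_nhds hκO₃)))).exists
    have := hv k (π k) (hπ k) (closure O₃) O₁ᶜ (subset_closure hkκ) (hk q (hU R).2.2.1)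
      ((Finset.range R).image A) ⟨fun B hB => ?_, fun B hB B' hB' hne => ?_⟩ fun B hB x hx => ?_
    · rwa [Separators.weight, Finset.sum_image hA.injOn,
        Finset.sum_congr rfl (g := fun _ => (1 : ENNReal)) (fun n _ => hwt n), Finset.sum_const,
        Finset.card_range, nsmul_eq_mul, mul_one] at this
    · obtain ⟨m, hm, rfl⟩ := Finset.mem_image.1 hB
      refine ⟨J.one_mem, (hneg m q).2 (hU m).2.2.1, (hpos m _).2 (subset_closure ?_)⟩
      exact hanti (Finset.mem_range.1 hm) hkv
    · obtain ⟨m, hm, rfl⟩ := Finset.mem_image.1 hB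
      obtain ⟨m', hm', rfl⟩ := Finset.mem_image.1 hB'
      rcases lt_trichotomy m m' with h | h | h
      · exact Or.inl (hnest _ _ h)
      · exact (hne (by rw [h])).elim
      · exact Or.inr (hnest _ _ h)
    · obtain ⟨m, hm, rfl⟩ := Finset.mem_image.1 hB
      rw [hpos] at hx
      exact hk x fun hc => hx (subset_closure (hanti (Finset.mem_range.1 hm) hc))
  have hL2 : P.crossingWeight J q (closure O₃) O₁ᶜ + 2 ≠ ⊤ :=
    ENNReal.add_ne_top.2 ⟨hL, ENNReal.ofNat_ne_top⟩
  obtain ⟨R, hR⟩ := ENNReal.exists_nat_gt hL2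
  exact (hbound R).not_gt hR

variable [Infinite M]

theorem not_isConicalLimitPt_of_boundedAt {ι : Type*} (P : Separators M ι)
    (hJ : IsDiscreteConvGroup J) {q : M} (hq : q ∉ limitSet J)
    (htest : ∀ O₁ ∈ TopologicalSpace.countableBasis M, ∀ O₃ ∈ TopologicalSpace.countableBasis M,
      closure O₃ ⊆ O₁ → P.crossingWeight J q (closure O₃) O₁ᶜ ≠ ⊤)
    (htype : ∀ O₁ ∈ TopologicalSpace.countableBasis M,
      ∀ O₂ ∈ TopologicalSpace.countableBasis M,
        Disjoint (closure O₂) (closure O₁) → (∃ x, x ∉ closure O₂ ∧ x ∉ closure O₁) →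
        ∃ i, P.N i = closure O₂ ∧ P.V i = closure O₁ ∧ P.wt i ≠ 0)
    {v : ℕ → M} (hv : ∀ k, P.BoundedAt J q (v k)) {z : M} (hz : z ∈ limitSet J)
    (hvz : Tendsto v atTop (𝓝 z)) : ¬IsConicalLimitPt J z := by
  classical
  intro hcon
  obtain ⟨g, hg, hi, a, b, hab, hconv, ha⟩ := hcon.exists_isConvSeq hJ
  obtain ⟨p, hpa, hpb⟩ := exists_ne_ne a b
  obtain ⟨Va, Vb, hVa, hVb, haV, hbV, hVV⟩ := t2_separation hab
  obtain ⟨O₁, hO₁, haO₁, hO₁V⟩ := exists_basis_nhds (U := Va ∩ {p}ᶜ)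
    (inter_mem (hVa.mem_nhds haV) (isOpen_compl_singleton.mem_nhds hpa.symm))
  obtain ⟨O₂, hO₂, hbO₂, hO₂V⟩ := exists_basis_nhds (U := Vb ∩ {p}ᶜ)
    (inter_mem (hVb.mem_nhds hbV) (isOpen_compl_singleton.mem_nhds hpb.symm))
  have hO₁o := TopologicalSpace.isOpen_of_mem_countableBasis hO₁
  have hO₂o := TopologicalSpace.isOpen_of_mem_countableBasis hO₂
  obtain ⟨O₃, hO₃, haO₃, hO₃O₁⟩ := exists_basis_nhds (hO₁o.mem_nhds haO₁)
  have hO₃o := TopologicalSpace.isOpen_of_mem_countableBasis hO₃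
  have hdis : Disjoint (closure O₂) (closure O₁) := disjoint_left.2 fun x h2 h1 =>
    disjoint_left.1 hVV (hO₁V h1).1 (hO₂V h2).1
  obtain ⟨i, hNi, hVi, hwt⟩ := htype O₁ hO₁ O₂ hO₂ hdis
    ⟨p, fun hc => (hO₂V hc).2 rfl, fun hc => (hO₁V hc).2 rfl⟩
  have hL := htest O₁ hO₁ O₃ hO₃ hO₃O₁
  have hneg : ∀ h x, x ∈ P.neg (h⁻¹, i) ↔ h x ∈ closure O₂ := fun h x => by
    simp [Separators.neg, hNi]
  have hpos : ∀ h x, x ∈ P.pos (h⁻¹, i) ↔ h x ∈ closure O₁ := fun h x => by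
    simp [Separators.pos, hVi]
  have hgq : ∀ᶠ n in atTop, g n q ∈ O₂ :=
    (hconv.tendsto_const (y := q) fun hc => hq (hc ▸ hz)).eventually (hO₂o.mem_nhds hbO₂)
  have hgz : ∀ᶠ n in atTop, g n z ∈ O₃ := ha.eventually (hO₃o.mem_nhds haO₃)
  have hnext : ∀ m, g m z ∈ O₃ → ∀ᶠ n in atTop, ∀ x, g m x ∉ closure O₁ → g n x ∈ O₂ := by
    intro m hm
    have hnb : (g m) ⁻¹' O₁ ∈ 𝓝 z := (g m).continuous.continuousAt.preimage_mem_nhds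
      (hO₁o.mem_nhds (hO₃O₁ (subset_closure hm)))
    filter_upwards [hconv.eventually_of_nhds (hO₂o.mem_nhds hbO₂) hnb] with n hn x hx
    exact hn x fun hc => hx (subset_closure hc)
  obtain ⟨s, hs, hsr⟩ := exists_seq_of_forall_finset_exists
    (fun n => g n q ∈ O₂ ∧ g n z ∈ O₃)
    (fun m n => ∀ x, g m x ∉ closure O₁ → g n x ∈ O₂) (fun S hS => by
      have := (Filter.eventually_all_finset S).2 fun m hm => hnext m (hS m hm).2
      obtain ⟨n, h1, h2, h3⟩ := (hgq.and (hgz.and this)).exists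
      exact ⟨n, ⟨h1, h2⟩, h3⟩)
  let A : ℕ → (M ≃ₜ M) × ι := fun r => ((g (s r))⁻¹, i)
  have hnest : ∀ m n, m < n → P.Nested (A m) (A n) := by
    intro m n hmn x hx
    rw [hpos] at hx
    rw [hneg]
    exact subset_closure (hsr m n hmn x hx)
  have hA : Function.Injective A := by
    intro m n hmn
    rcases lt_trichotomy m n with h | h | h
    · exact (Separators.not_nested_self _ (hmn ▸ hnest m n h)).elim
    · exact h
    · exact (Separators.not_nested_self _ (hmn ▸ hnest n m h)).elim
  have hbound : ∀ R : ℕ, R * P.wt i ≤ P.crossingWeight J q (closure O₃) O₁ᶜ + 2 := by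
    intro R
    have h1 : ∀ᶠ n in atTop, ∀ m ∈ Finset.range R, ∀ x, g (s m) x ∉ closure O₁ → g n x ∈ O₂ :=
      (Filter.eventually_all_finset _).2 fun m _ => hnext _ (hs m).2
    obtain ⟨n, hnq, hnz, hn⟩ := (hgq.and (hgz.and h1)).exists
    have h2 : ∀ᶠ k in atTop, ∀ m ∈ Finset.range R, g (s m) (v k) ∈ O₁ :=
      (Filter.eventually_all_finset _).2 fun m _ =>
        (((g (s m)).continuous.tendsto z).comp hvz).eventually
          (hO₁o.mem_nhds (hO₃O₁ (subset_closure (hs m).2)))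
    have h3 : ∀ᶠ k in atTop, g n (v k) ∈ O₃ :=
      (((g n).continuous.tendsto z).comp hvz).eventually (hO₃o.mem_nhds hnz)
    obtain ⟨k, hk, hkn⟩ := (h2.and h3).exists
    have hO₂O₁ : ∀ x ∈ O₂, x ∈ O₁ᶜ := fun x h2 h1 =>
      disjoint_left.1 hdis (subset_closure h2) (subset_closure h1)
    have := hv k (g n) (hg n) (closure O₃) O₁ᶜ (subset_closure hkn) (hO₂O₁ _ hnq)
      ((Finset.range R).image A) ⟨fun B hB => ?_, fun B hB B' hB' hne => ?_⟩ fun B hB x hx => ?_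
    · rwa [Separators.weight, Finset.sum_image hA.injOn,
        Finset.sum_congr rfl (g := fun _ => P.wt i) (fun _ _ => rfl), Finset.sum_const,
        Finset.card_range, nsmul_eq_mul] at this
    · obtain ⟨m, hm, rfl⟩ := Finset.mem_image.1 hB
      refine ⟨J.inv_mem (hg _), ?_, ?_⟩
      · rw [hneg]
        exact subset_closure (hs m).1
      · rw [hpos]
        exact subset_closure (hk m hm)
    · obtain ⟨m, hm, rfl⟩ := Finset.mem_image.1 hB
      obtain ⟨m', hm', rfl⟩ := Finset.mem_image.1 hB'
      rcases lt_trichotomy m m' with h | h | h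
      · exact Or.inl (hnest _ _ h)
      · exact (hne (by rw [h])).elim
      · exact Or.inr (hnest _ _ h)
    · obtain ⟨m, hm, rfl⟩ := Finset.mem_image.1 hB
      rw [hpos] at hx
      exact hO₂O₁ _ (hn m hm x hx)
  have hL2 : P.crossingWeight J q (closure O₃) O₁ᶜ + 2 ≠ ⊤ :=
    ENNReal.add_ne_top.2 ⟨hL, ENNReal.ofNat_ne_top⟩
  obtain ⟨R, hR⟩ := ENNReal.exists_nat_mul_gt hwt hL2
  exact (hbound R).not_gt hR

/-- Orbit representatives lying in a kind of Dirichlet domain centered at `q`. -/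
theorem exists_orbit_representatives (hJ : IsDiscreteConvGroup J) {q : M} (hq : q ∉ limitSet J)
    {w : ℕ → M} (hw : ∀ k, w k ∉ limitSet J) :
    ∃ j : ℕ → M ≃ₜ M, (∀ k, j k ∈ J) ∧ ∀ φ : ℕ → ℕ, ∀ z ∈ limitSet J,
      Tendsto (fun k => j (φ k) (w (φ k))) atTop (𝓝 z) → ¬IsConicalLimitPt J z ∧
        (IsParabolicPt J z → ∀ π : ℕ → M ≃ₜ M, (∀ k, π k ∈ J) → IsConvSeq π z z →
          ∀ κ, Tendsto (fun k => π k (j (φ k) (w (φ k)))) atTop (𝓝 κ) → κ = z) := by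
  set b := TopologicalSpace.countableBasis M
  have hbc : b.Countable := TopologicalSpace.countable_countableBasis M
  set τ₁ : Set (Set M × Set M) := (fun p : Set M × Set M => (closure p.2, p.1ᶜ)) ''
    {p | (p.1 ∈ b ∧ p.2 ∈ b) ∧ closure p.2 ⊆ p.1}
  set τ₂ : Set (Set M × Set M) := (fun p : (M ≃ₜ M) × ℕ => ({p.1 (w p.2)}, {p.1 (w p.2)})) ''
    ((J : Set (M ≃ₜ M)) ×ˢ Set.univ)
  have hτ : (τ₁ ∪ τ₂).Countable := by
    refine Set.Countable.union ?_ ?_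
    · exact ((hbc.prod hbc).mono fun p hp => hp.1).image _
    · exact ((countable_of_notMem_limitSet hJ hq).prod Set.countable_univ).image _
  have hne : (τ₁ ∪ τ₂).Nonempty := ⟨_, Or.inr ⟨(1, 0), ⟨J.one_mem, trivial⟩, rfl⟩⟩
  obtain ⟨τ, hτr⟩ := hτ.exists_eq_range hne
  have hprop : ∀ t ∈ τ₁ ∪ τ₂, IsClosed t.1 ∧ IsClosed t.2 ∧
      ∀ x ∈ t.1, x ∈ t.2 → x ∉ limitSet J := by
    rintro t (⟨p, ⟨⟨hp1, hp2⟩, hp⟩, rfl⟩ | ⟨⟨h, k⟩, ⟨hh, -⟩, rfl⟩)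
    · exact ⟨isClosed_closure,
        (TopologicalSpace.isOpen_of_mem_countableBasis hp1).isClosed_compl,
        fun x h1 h2 => (h2 (hp h1)).elim⟩
    · refine ⟨isClosed_singleton, isClosed_singleton, ?_⟩
      rintro x rfl -
      exact fun hc => hw k ((app_mem_limitSet_iff hh).1 hc)
  have hmem : ∀ l, τ l ∈ τ₁ ∪ τ₂ := fun l => hτr ▸ mem_range_self l
  obtain ⟨ι, P, hP, htype, hpar⟩ := exists_separators hJ hq
    (fun l => (hprop _ (hmem l)).1) (fun l => (hprop _ (hmem l)).2.1)
    (fun l => (hprop _ (hmem l)).2.2)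
  have hP' : ∀ t ∈ τ₁ ∪ τ₂, P.crossingWeight J q t.1 t.2 ≠ ⊤ := by
    intro t ht
    rw [hτr] at ht
    obtain ⟨l, rfl⟩ := ht
    exact hP l
  have htest : ∀ O₁ ∈ b, ∀ O₃ ∈ b, closure O₃ ⊆ O₁ →
      P.crossingWeight J q (closure O₃) O₁ᶜ ≠ ⊤ := fun O₁ h1 O₃ h3 h =>
    hP' (closure O₃, O₁ᶜ) (Or.inl ⟨(O₁, O₃), ⟨⟨h1, h3⟩, h⟩, rfl⟩)
  choose j hj hjb using fun k => Separators.exists_almost_minimal (P := P) (J := J) (q := q) (w k)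
    fun g hg => hP' ({g (w k)}, {g (w k)}) (Or.inr ⟨(g, k), ⟨hg, trivial⟩, rfl⟩)
  refine ⟨j, hj, fun φ z hz hvz => ⟨?_, fun hzp π hπ hc κ hκ => ?_⟩⟩
  · exact not_isConicalLimitPt_of_boundedAt P hJ hq htest htype (fun k => hjb (φ k)) hz hvz
  · by_contra hne
    obtain ⟨U, hU, hUi⟩ := hpar z hzp
    exact false_of_boundedAt_parabolic P htest (fun k => hjb (φ k)) hU hUi hvz hπ hc hne hκ

end Dirichlet

section Cosets

variable {G J : Subgroup (M ≃ₜ M)}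

theorem IsParabolicPt.mono (hJG : J ≤ G) {z : M} (hz : IsParabolicPt J z) : IsParabolicPt G z := by
  obtain ⟨g, hg, h⟩ := hz
  exact ⟨g, hJG hg, h⟩

variable [CompactSpace M] [T2Space M] [Infinite M] [SecondCountableTopology M]

/-- Points of infinitely many distinct translates `h k B` accumulate only at the limit set. -/
theorem mem_limitSet_of_tendsto_translates (hG : IsDiscreteConvGroup G) (hJG : J ≤ G)
    (hgf : IsGeomFinite J) {B : Set M} (hB : IsClosed B) (hinv : ∀ j ∈ J, ∀ x ∈ B, j x ∈ B)
    (hlim : ∀ x ∈ limitSet G, x ∈ B → x ∈ limitSet J)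
    (hstab : ∀ z ∈ limitSet J, ∀ g ∈ G, g z = z → g ∈ J)
    (hbd : ∀ z ∈ limitSet J, IsParabolicPt J z → ∃ K, IsClosed K ∧ z ∉ K ∧
      ∀ u ∈ limitSet G, u ≠ z → ∃ π ∈ J, π z = z ∧ π u ∈ K)
    {h : ℕ → M ≃ₜ M} (hh : ∀ k, h k ∈ G) (hcos : ∀ m n, m ≠ n → (h m)⁻¹ * h n ∉ J)
    {y : ℕ → M} (hy : ∀ k, y k ∈ B) {x : M} (hx : Tendsto (fun k => h k (y k)) atTop (𝓝 x)) :
    x ∈ limitSet G := by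
  by_contra hxG
  have hJ := hG.mono hJG
  have hxJ : x ∉ limitSet J := fun hc => hxG (limitSet_mono hJG hc)
  have hw : ∀ k, (h k)⁻¹ x ∉ limitSet J := fun k hc =>
    hxG ((app_mem_limitSet_iff (G.inv_mem (hh k))).1 (limitSet_mono hJG hc))
  obtain ⟨j, hj, hjz⟩ := exists_orbit_representatives hJ hxJ hw
  set σ : ℕ → M ≃ₜ M := fun k => h k * (j k)⁻¹
  have hσG : ∀ k, σ k ∈ G := fun k => G.mul_mem (hh k) (G.inv_mem (hJG (hj k)))
  have hσcos : ∀ m n, m ≠ n → (σ m)⁻¹ * σ n ∉ J := by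
    intro m n hmn hc
    refine hcos m n hmn ?_
    have := J.mul_mem (J.mul_mem (J.inv_mem (hj m)) hc) (hj n)
    simpa [σ, mul_assoc] using this
  have hσi : Function.Injective σ := by
    intro m n hmn
    by_contra hne
    exact hσcos m n hne (by rw [hmn]; simp)
  have hσx : ∀ k, (σ k)⁻¹ x = j k ((h k)⁻¹ x) := fun k => by
    simp [σ]
  obtain ⟨φ, hφ, e', z, hσ⟩ := hG σ hσG hσi
  have hφi := hφ.injective
  have hzG : z ∈ limitSet G := hσ.repelling_mem_limitSet (fun k => hσG _) (hσi.comp hφi)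
  have heG : e' ∈ limitSet G := ⟨_, fun k => hσG _, hσi.comp hφi, z, hσ⟩
  by_cases hzJ : z ∈ limitSet J
  swap
  · have hzB : z ∉ B := fun hc => hzJ (hlim z hzG hc)
    have ht : Tendsto (fun k => h (φ k) (y (φ k))) atTop (𝓝 e') := by
      intro U hU
      change ∀ᶠ k in atTop, h (φ k) (y (φ k)) ∈ U
      filter_upwards [hσ B hB.isCompact hzB U hU] with k hk
      have := hk _ (hinv _ (hj (φ k)) _ (hy (φ k)))
      simpa [σ, mul_app, inv_app] using this
    have := tendsto_nhds_unique (hx.comp hφ.tendsto_atTop) ht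
    exact hxG (this ▸ heG)
  have hwz : Tendsto (fun k => (σ (φ k))⁻¹ x) atTop (𝓝 z) :=
    hσ.inv.tendsto_const (y := x) fun hc => hxG (hc ▸ heG)
  have hnc : ¬IsConicalLimitPt J z := (hjz φ z hzJ (by simpa [hσx] using hwz)).1
  have hp : IsParabolicPt J z := ((hgf z hzJ).resolve_left hnc).1
  have hncG : ¬IsConicalLimitPt G z := (hp.mono hJG).not_isConicalLimitPt hG
  obtain ⟨K, hK, hzK, hKu⟩ := hbd z hzJ hp
  set u := σ (φ 0) z
  have hu : ∀ k, (σ (φ (k + 1)))⁻¹ u ≠ z := by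
    intro k hc
    exact hσcos (φ (k + 1)) (φ 0) (hφi.ne (Nat.succ_ne_zero k))
      (hstab z hzJ _ (G.mul_mem (G.inv_mem (hσG _)) (hσG _)) hc)
  have huG : ∀ k, (σ (φ (k + 1)))⁻¹ u ∈ limitSet G := fun k =>
    app_mem_limitSet (G.inv_mem (hσG _)) (app_mem_limitSet (hσG _) hzG)
  choose π hπJ hπz hπK using fun k => hKu _ (huG k) (hu k)
  set τ : ℕ → M ≃ₜ M := fun k => π k * (σ (φ (k + 1)))⁻¹
  have hτG : ∀ k, τ k ∈ G := fun k => G.mul_mem (hJG (hπJ k)) (G.inv_mem (hσG _))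
  have hτi : Function.Injective τ := by
    intro m n hmn
    by_contra hne
    refine hσcos (φ (m + 1)) (φ (n + 1)) (hφi.ne (fun hc => hne (Nat.succ_injective hc))) ?_
    have : (σ (φ (m + 1)))⁻¹ * σ (φ (n + 1)) = (π m)⁻¹ * π n := by
      have h1 : π m * (σ (φ (m + 1)))⁻¹ = π n * (σ (φ (n + 1)))⁻¹ := hmn
      rw [eq_inv_mul_iff_mul_eq, ← mul_assoc, h1, inv_mul_cancel_right]
    rw [this]
    exact J.mul_mem (J.inv_mem (hπJ m)) (hπJ n)
  obtain ⟨ψ, hψ, c, e, hτ⟩ := hG τ hτG hτi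
  obtain ⟨κ, χ, hχ, hκ⟩ := CompactSpace.tendsto_subseq fun k => τ (ψ k) u
  have hτ' := hτ.comp hχ
  have hψχ := hψ.comp hχ
  have hκK : κ ∈ K := hK.mem_of_tendsto hκ (Eventually.of_forall fun k => hπK _)
  have hcK : c ∈ K := by
    by_cases hue : u = e
    · by_contra hcK
      have hκc : κ ≠ c := fun hc => hcK (hc ▸ hκK)
      refine hncG (isConicalLimitPt_of_isConvSeq (g := fun k => τ (ψ (χ k)) * σ (φ 0))
        (fun k => G.mul_mem (hτG _) (hσG _)) ?_ ?_ hκ hκc)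
      · exact fun m n hmn => hψχ.injective (hτi (mul_right_cancel hmn))
      · have := hτ'.mul_right (σ (φ 0))
        rwa [← hue, inv_app] at this
    · rwa [← tendsto_nhds_unique hκ (hτ'.tendsto_const hue)]
  have hcz : c ≠ z := fun hc => hzK (hc ▸ hcK)
  have heG' : e ∈ limitSet G := hτ.repelling_mem_limitSet (fun k => hτG _) (hτi.comp hψ.injective)
  have hτx : Tendsto (fun k => τ (ψ k) x) atTop (𝓝 c) :=
    hτ.tendsto_const (y := x) fun hc => hxG (hc ▸ heG')
  obtain ⟨ξ, hξ, ⟨p, hpc⟩ | hπi⟩ := exists_strictMono_const_or_injective fun k => π (ψ k)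
  · have h1 : Tendsto (fun k => (σ (φ (ψ (ξ k) + 1)))⁻¹ x) atTop (𝓝 z) :=
      hwz.comp ((tendsto_add_atTop_nat 1).comp (hψ.comp hξ).tendsto_atTop)
    have h2 := (p.continuous.tendsto z).comp h1
    have h3 : p z = z := hpc 0 ▸ hπz _
    rw [h3] at h2
    refine hcz (tendsto_nhds_unique (hτx.comp hξ.tendsto_atTop) ?_)
    refine h2.congr fun k => ?_
    simp only [Function.comp_apply, τ, mul_app, ← hpc k]
  · obtain ⟨η, hη, c', e'', hπ⟩ := hJ _ (fun k => hπJ (ψ (ξ k))) hπi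
    have hθ : StrictMono fun k => ψ (ξ (η k)) := hψ.comp (hξ.comp hη)
    have h1 : Tendsto (fun k => (σ (φ (ψ (ξ (η k)) + 1)))⁻¹ x) atTop (𝓝 z) :=
      hwz.comp ((tendsto_add_atTop_nat 1).comp hθ.tendsto_atTop)
    have h2 : Tendsto (fun k => π (ψ (ξ (η k))) ((σ (φ (ψ (ξ (η k)) + 1)))⁻¹ x)) atTop (𝓝 c) :=
      hτx.comp (hξ.comp hη).tendsto_atTop
    have hfix := hπ.eq_of_fixed (y := z) fun k => hπz _
    have hez : z = e'' := by
      by_contra hne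
      exact hcz ((tendsto_nhds_unique h2 (hπ.tendsto h1 hne)).trans
        (hfix.resolve_right hne).symm)
    subst hez
    have hcz' : c' = z := by
      by_contra hne
      refine hnc (isConicalLimitPt_of_isConvSeq (fun k => hπJ _) (hπi.comp hη.injective) hπ
        (a := z) ?_ (Ne.symm hne))
      simp [hπz]
    subst hcz'
    simp only [hσx] at h1 h2
    exact hcz ((hjz (fun k => φ (ψ (ξ (η k)) + 1)) _ hzJ h1).2 hp _ (fun k => hπJ _) hπ c h2)

end Cosets

section PingPong

/-- Consecutive quotients of a convergent sequence of homeomorphisms tend to the identity. -/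
theorem TendstoHomeo.tendsto_inv_mul [CompactSpace M] [T2Space M] {g : ℕ → M ≃ₜ M}
    (hg : TendstoHomeo g) (x : M) :
    Tendsto (fun n => ((g n)⁻¹ * g (n + 1)) x) atTop (𝓝 x) := by
  obtain ⟨t, ht⟩ := hg
  rw [tendsto_nhds]
  intro U hU hxU
  have hC : IsCompact (⇑t '' Uᶜ) := hU.isClosed_compl.isCompact.image t.continuous
  have hx : t x ∉ ⇑t '' Uᶜ := by
    rw [t.injective.mem_set_image]
    exact not_not.2 hxU
  obtain ⟨V, W, hV, hW, hxV, hCW, hVW⟩ := SeparatedNhds.of_isCompact_isCompact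
    isCompact_singleton hC (disjoint_singleton_left.2 hx)
  have h1 : ∀ᶠ n in atTop, MapsTo (toCM (g n)) Uᶜ W :=
    ht.eventually ((ContinuousMap.isOpen_setOfPred_mapsTo hU.isClosed_compl.isCompact hW).mem_nhds
      (fun y hy => hCW (mem_image_of_mem _ hy)))
  have h2 : ∀ᶠ n in atTop, MapsTo (toCM (g n)) {x} V :=
    ht.eventually ((ContinuousMap.isOpen_setOfPred_mapsTo isCompact_singleton hV).mem_nhds
      (fun y hy => hxV (by rw [mem_singleton_iff.1 hy]; rfl)))
  filter_upwards [h1, (tendsto_add_atTop_nat 1).eventually h2] with n hn hn'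
  by_contra hc
  refine disjoint_left.1 hVW (hn' rfl) ?_
  have := hn hc
  rw [show toCM (g n) (((g n)⁻¹ * g (n + 1)) x) = g (n + 1) x from app_inv _ _] at this
  exact this

/-- Symmetric form of the HNN ping-pong position: the stable letters `F true = f` and
`F false = f⁻¹` are treated on the same footing. -/
structure SymmPingPong (G₀ : Subgroup (M ≃ₜ M)) (J : Bool → Subgroup (M ≃ₜ M))
    (F : Bool → M ≃ₜ M) (B : Bool → Set M) : Prop where
  le : ∀ s, J s ≤ G₀
  closed : ∀ s, IsClosed (B s)
  inv : ∀ s, ∀ j ∈ J s, ∀ x ∈ B s, j x ∈ B s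
  prec : ∀ s s', ∀ g ∈ G₀, ∀ x ∈ B s, g x ∈ B s' → s = s' ∧ g ∈ J s
  F_not : ∀ s, F (!s) = (F s)⁻¹
  maps : ∀ s, ∀ x ∉ B (!s), F s x ∈ interior (B s)
  conj : ∀ s x, x ∈ J s ↔ (F s)⁻¹ * x * F s ∈ J (!s)
  lim : ∀ s, limitSet G₀ ∩ B s = limitSet (J s)
  nontrivial : ∀ s, (interior (B s)).Nontrivial
  notMem_interior : ∀ s, ∀ x ∈ limitSet (J s), x ∉ interior (B s)

/-- `Red G₀ J F g h s k t`: the element `g` has a reduced expression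
`h * F s * ⋯ * F t * k` in the stable letters `F` and the elements of `G₀`. -/
inductive Red (G₀ : Subgroup (M ≃ₜ M)) (J : Bool → Subgroup (M ≃ₜ M)) (F : Bool → M ≃ₜ M) :
    (M ≃ₜ M) → (M ≃ₜ M) → Bool → (M ≃ₜ M) → Bool → Prop
  | single {h k : M ≃ₜ M} (s : Bool) (hh : h ∈ G₀) (hk : k ∈ G₀) :
      Red G₀ J F (h * F s * k) h s k s
  | cons {g h h' k : M ≃ₜ M} {s' t : Bool} (s : Bool) (hh : h ∈ G₀)
      (hg : Red G₀ J F g h' s' k t) (hn : ¬(s' = !s ∧ h' ∈ J s')) :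
      Red G₀ J F (h * F s * g) h s k t

variable {G₀ : Subgroup (M ≃ₜ M)} {J : Bool → Subgroup (M ≃ₜ M)} {F : Bool → M ≃ₜ M}
  {B : Bool → Set M}

namespace Red

variable {g h k p : M ≃ₜ M} {s t : Bool}

theorem left_mem (hg : Red G₀ J F g h s k t) : h ∈ G₀ := by
  cases hg <;> assumption

theorem right_mem (hg : Red G₀ J F g h s k t) : k ∈ G₀ := by
  induction hg <;> assumption

theorem mul_left (hg : Red G₀ J F g h s k t) (hp : p ∈ G₀) :
    Red G₀ J F (p * g) (p * h) s k t := by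
  cases hg with
  | single _ hh hk => simpa [mul_assoc] using single (J := J) (F := F) s (G₀.mul_mem hp hh) hk
  | cons _ hh hg hn => simpa [mul_assoc] using cons s (G₀.mul_mem hp hh) hg hn

end Red

namespace SymmPingPong

variable {g h k p : M ≃ₜ M} {s t u : Bool} {x z : M}

theorem conj_not (hP : SymmPingPong G₀ J F B) (hx : p ∈ J (!s)) : F s * p * (F s)⁻¹ ∈ J s := by
  rw [hP.conj]
  simpa [mul_assoc] using hx

theorem limitSet_subset (hP : SymmPingPong G₀ J F B) (hx : x ∈ limitSet (J s)) : x ∈ B s := by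
  rw [← hP.lim] at hx
  exact hx.2

theorem inv_F_mem (hP : SymmPingPong G₀ J F B) (hx : x ∉ interior (B s)) :
    (F s)⁻¹ x ∈ B (!s) := by
  by_contra hc
  exact hx (by simpa [app_inv] using hP.maps s _ hc)

theorem inv_F_mem_limitSet (hP : SymmPingPong G₀ J F B) (hx : x ∈ limitSet (J s)) :
    (F s)⁻¹ x ∈ limitSet (J (!s)) :=
  app_mem_limitSet_of_conj (fun p hp => by simpa using (hP.conj s p).1 hp) hx

theorem F_mem_limitSet (hP : SymmPingPong G₀ J F B) (hx : x ∈ limitSet (J (!s))) :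
    F s x ∈ limitSet (J s) :=
  app_mem_limitSet_of_conj (fun _ hp => hP.conj_not hp) hx

theorem F_mem_of_mem_closure (hP : SymmPingPong G₀ J F B) (hx : x ∈ closure (B (!s))ᶜ) :
    F s x ∈ B s := by
  have h : MapsTo (F s) (B (!s))ᶜ (B s) := fun y hy => interior_subset (hP.maps s y hy)
  simpa [(hP.closed s).closure_eq] using h.closure (F s).continuous hx

theorem red_mem_interior (hP : SymmPingPong G₀ J F B) (hg : Red G₀ J F g h s k t)
    (hx : k x ∉ B (!t)) : h⁻¹ (g x) ∈ interior (B s) := by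
  induction hg with
  | single s hh hk => simpa [mul_app, inv_app] using hP.maps s _ hx
  | @cons g h h' k s' t s hh hg hn ih =>
    have := ih hx
    rw [mul_app, mul_app, inv_app]
    refine hP.maps s _ fun hc => hn ?_
    obtain ⟨rfl, h'J⟩ := hP.prec s' (!s) h' hg.left_mem _ (interior_subset this)
      (by rwa [app_inv])
    exact ⟨rfl, h'J⟩

theorem red_mem (hP : SymmPingPong G₀ J F B) (hg : Red G₀ J F g h s k t)
    (hx : k x ∈ closure (B (!t))ᶜ) : h⁻¹ (g x) ∈ B s := by
  induction hg with
  | single s hh hk => simpa [mul_app, inv_app] using hP.F_mem_of_mem_closure hx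
  | @cons g h h' k s' t s hh hg hn ih =>
    have := ih hx
    rw [mul_app, mul_app, inv_app]
    refine interior_subset (hP.maps s _ fun hc => hn ?_)
    obtain ⟨rfl, h'J⟩ := hP.prec s' (!s) h' hg.left_mem _ this (by rwa [app_inv])
    exact ⟨rfl, h'J⟩

theorem inv_F_mul_red (hP : SymmPingPong G₀ J F B) (hg : Red G₀ J F g h s k t) (hh : h ∈ J s) :
    (F s)⁻¹ * g ∈ G₀ ∨
      ∃ h' s', Red G₀ J F ((F s)⁻¹ * g) h' s' k t ∧ ¬(s' = !s ∧ h' ∈ J s') := by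
  have hj := (hP.conj s h).1 hh
  cases hg with
  | single _ _ hk =>
    left
    simpa [mul_assoc] using G₀.mul_mem (hP.le _ hj) hk
  | @cons g' _ h' _ s' _ _ _ hg hn =>
    right
    refine ⟨_, s', by simpa [mul_assoc] using hg.mul_left (hP.le _ hj), fun hc => hn ?_⟩
    obtain ⟨rfl, hc⟩ := hc
    refine ⟨rfl, ?_⟩
    rw [← mul_assoc, ← mul_assoc] at hc
    exact ((J (!s)).mul_mem_cancel_left hj).1 hc

theorem F_mul (hP : SymmPingPong G₀ J F B)
    (hg : g ∈ G₀ ∨ ∃ h s k t, Red G₀ J F g h s k t) (u : Bool) :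
    F u * g ∈ G₀ ∨ ∃ h s k t, Red G₀ J F (F u * g) h s k t := by
  rcases hg with hg | ⟨h, s, k, t, hg⟩
  · exact Or.inr ⟨1, u, g, u, by simpa using Red.single (J := J) (F := F) u G₀.one_mem hg⟩
  by_cases hc : s = !u ∧ h ∈ J s
  · obtain ⟨rfl, hh⟩ := hc
    have h' := hP.inv_F_mul_red hg hh
    rw [hP.F_not, inv_inv] at h'
    exact h'.imp_right fun ⟨h', s', hr, _⟩ => ⟨h', s', k, t, hr⟩
  · exact Or.inr ⟨1, u, k, t, by simpa using Red.cons u G₀.one_mem hg hc⟩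

theorem mem_or_red (hP : SymmPingPong G₀ J F B)
    (hg : g ∈ G₀ ⊔ Subgroup.zpowers (F true)) :
    g ∈ G₀ ∨ ∃ h s k t, Red G₀ J F g h s k t := by
  have hmul : ∀ p ∈ G₀, ∀ g, (g ∈ G₀ ∨ ∃ h s k t, Red G₀ J F g h s k t) →
      (p * g ∈ G₀ ∨ ∃ h s k t, Red G₀ J F (p * g) h s k t) := by
    rintro p hp g (hg | ⟨h, s, k, t, hg⟩)
    · exact Or.inl (G₀.mul_mem hp hg)
    · exact Or.inr ⟨_, s, k, t, hg.mul_left hp⟩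
  rw [← Subgroup.closure_eq G₀, Subgroup.zpowers_eq_closure, ← Subgroup.closure_union] at hg
  induction hg using Subgroup.closure_induction_left with
  | one => exact Or.inl G₀.one_mem
  | mul_left p hp g _ ih =>
    rcases hp with hp | rfl
    · exact hmul p hp g ih
    · exact hP.F_mul ih true
  | inv_mul_cancel p hp g _ ih =>
    rcases hp with hp | rfl
    · exact hmul _ (G₀.inv_mem hp) g ih
    · exact hP.F_not true ▸ hP.F_mul ih (!true)

theorem mem_of_fixed (hP : SymmPingPong G₀ J F B) (hz : z ∈ limitSet (J s))
    (hg : g ∈ G₀ ⊔ Subgroup.zpowers (F true)) (hgz : g z = z) : g ∈ J s := by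
  have hzB := hP.limitSet_subset hz
  rcases hP.mem_or_red hg with hg | ⟨h, s', k, t, hg⟩
  · exact (hP.prec s s g hg z hzB (hgz.symm ▸ hzB)).2
  have hk : k z ∈ closure (B (!t))ᶜ := by
    rw [closure_compl]
    intro hc
    obtain ⟨rfl, hk⟩ := hP.prec s (!t) k hg.right_mem z hzB (interior_subset hc)
    exact hP.notMem_interior _ _ (app_mem_limitSet hk hz) hc
  obtain ⟨rfl, hh⟩ := hP.prec s' s h hg.left_mem _ (hP.red_mem hg hk)
    (by rwa [app_inv, hgz])
  have hz' : ((F s')⁻¹ * g) z ∈ B (!s') := by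
    rw [mul_app, hgz]
    exact hP.limitSet_subset (hP.inv_F_mem_limitSet hz)
  rcases hP.inv_F_mul_red hg hh with hg' | ⟨h', s'', hg', hn⟩
  · exact absurd (hP.prec _ _ _ hg' z hzB hz').1 (by simp)
  · obtain ⟨rfl, hh'⟩ := hP.prec s'' (!s') h' hg'.left_mem _ (hP.red_mem hg' hk)
      (by rwa [app_inv])
    exact (hn ⟨rfl, hh'⟩).elim

theorem exists_region (hP : SymmPingPong G₀ J F B) {r : ℕ → M ≃ₜ M} (hr : ∀ i, r i ∈ G₀)
    (hcos : ∀ m n, m ≠ n → (r m)⁻¹ * r n ∉ J u) (hg : Red G₀ J F g h s k t)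
    {b : M} (hb : b ∈ B u) : ∃ i < 3, (r i)⁻¹ (g (r i b)) ∉ B u := by
  have huniq : ∀ p ∈ G₀, ∀ s, ∀ i j, ∀ x ∈ B u, ∀ y ∈ B u, p (r i x) ∈ B s → p (r j y) ∈ B s →
      i = j := by
    intro p hp s i j x hx y hy hi hj
    by_contra hne
    have hi' := (hP.prec u s (p * r i) (G₀.mul_mem hp (hr i)) x hx hi).2
    have hj' := (hP.prec u s (p * r j) (G₀.mul_mem hp (hr j)) y hy hj).2
    refine hcos i j hne ?_
    have := (J u).mul_mem ((J u).inv_mem hi') hj'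
    simpa [mul_assoc] using this
  by_contra! hall
  have hor : ∀ i < 3, k (r i b) ∈ B (!t) ∨ h⁻¹ (r i ((r i)⁻¹ (g (r i b)))) ∈ B s := by
    intro i _
    by_cases hc : k (r i b) ∈ B (!t)
    · exact Or.inl hc
    · right
      rw [app_inv]
      exact interior_subset (hP.red_mem_interior hg hc)
  have hk := fun i j => huniq k hg.right_mem (!t) i j b hb b hb
  have hh := fun i j (hi : i < 3) (hj : j < 3) =>
    huniq h⁻¹ (G₀.inv_mem hg.left_mem) s i j _ (hall i hi) _ (hall j hj)
  have h01 := hk 0 1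
  have h02 := hk 0 2
  have h12 := hk 1 2
  have g01 := hh 0 1 (by norm_num) (by norm_num)
  have g02 := hh 0 2 (by norm_num) (by norm_num)
  have g12 := hh 1 2 (by norm_num) (by norm_num)
  have o0 := hor 0 (by norm_num)
  have o1 := hor 1 (by norm_num)
  have o2 := hor 2 (by norm_num)
  clear huniq hall hor hk hh
  grind

variable [CompactSpace M] [T2Space M] [Infinite M]

theorem isDiscreteConvGroup (hP : SymmPingPong G₀ J F B) (hd : IsDiscreteConvGroup G₀)
    (hG : IsConvGroup (G₀ ⊔ Subgroup.zpowers (F true))) {r : ℕ → M ≃ₜ M} (hr : ∀ i, r i ∈ G₀)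
    (hcos : ∀ m n, m ≠ n → (r m)⁻¹ * r n ∉ J u) :
    IsDiscreteConvGroup (G₀ ⊔ Subgroup.zpowers (F true)) := by
  intro g hg hi
  obtain ⟨φ, hφ, ht | hc⟩ := hG g hg hi
  swap
  · exact ⟨φ, hφ, hc⟩
  exfalso
  set σ : ℕ → M ≃ₜ M := fun n => ((g ∘ φ) n)⁻¹ * (g ∘ φ) (n + 1)
  have hσ : ∀ x, Tendsto (fun n => σ n x) atTop (𝓝 x) := ht.tendsto_inv_mul
  have hσne : ∀ n, σ n ≠ 1 := fun n hc =>
    (n.lt_succ_self).ne (hφ.injective (hi (inv_mul_eq_one.1 hc)))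
  obtain ⟨b, hb⟩ := (hP.nontrivial u).nonempty
  have hev : ∀ i, ∀ᶠ n in atTop, (r i)⁻¹ (σ n (r i b)) ∈ B u := fun i => by
    have h1 := ((r i)⁻¹.continuous.tendsto (r i b)).comp (hσ (r i b))
    rw [inv_app] at h1
    exact h1.eventually (mem_interior_iff_mem_nhds.1 hb)
  obtain ⟨N, hN⟩ := eventually_atTop.1 ((hev 0).and ((hev 1).and (hev 2)))
  have hmem : ∀ n, σ (N + n) ∈ G₀ := fun n => by
    obtain ⟨h0, h1, h2⟩ := hN (N + n) (by omega)
    rcases hP.mem_or_red (Subgroup.mul_mem _ (Subgroup.inv_mem _ (hg (φ (N + n))))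
      (hg (φ (N + n + 1)))) with h | ⟨h, s, k, t, hred⟩
    · exact h
    · obtain ⟨i, hi3, hni⟩ := hP.exists_region hr hcos hred (interior_subset hb)
      interval_cases i
      exacts [(hni h0).elim, (hni h1).elim, (hni h2).elim]
  have hadd : StrictMono fun n => N + n := fun _ _ h => Nat.add_lt_add_left h N
  obtain ⟨ψ, hψ, ⟨a, ha⟩ | hinj⟩ := exists_strictMono_const_or_injective fun n => σ (N + n)
  · refine hσne (N + ψ 0) ?_
    rw [ha 0]
    ext x
    refine tendsto_nhds_unique ?_ ((hσ x).comp (hadd.comp hψ).tendsto_atTop)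
    simp [Function.comp_def, ha]
  · obtain ⟨χ, hχ, zp, zm, hz⟩ := hd _ (fun k => hmem (ψ k)) hinj
    obtain ⟨y, hyp, hym⟩ := exists_ne_ne zp zm
    exact hyp (tendsto_nhds_unique ((hσ y).comp (hadd.comp (hψ.comp hχ)).tendsto_atTop)
      (hz.tendsto_const hym))

variable [SecondCountableTopology M]

/-- A group containing `G₀` in which the stabilizers of the limit points of `J s` lie in `J s`
provides compact sets of representatives for the parabolic points of `J s`. -/
theorem exists_isClosed_of_isParabolicPt {H : Subgroup (M ≃ₜ M)} (hd : IsDiscreteConvGroup H)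
    (hgf : IsGeomFinite H) (h₀ : G₀ ≤ H) {J : Subgroup (M ≃ₜ M)} (hJ : J ≤ H)
    (hstab : ∀ z ∈ limitSet J, ∀ g ∈ H, g z = z → g ∈ J) (hz : z ∈ limitSet J)
    (hp : IsParabolicPt J z) : ∃ K, IsClosed K ∧ z ∉ K ∧
      ∀ u ∈ limitSet G₀, u ≠ z → ∃ π ∈ J, π z = z ∧ π u ∈ K := by
  obtain ⟨-, K, hK, hKs, hKr⟩ := (hgf z (limitSet_mono hJ hz)).resolve_left
    (IsParabolicPt.not_isConicalLimitPt hd (hp.mono hJ))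
  refine ⟨K, hK.isClosed, fun hc => (hKs hc).2 rfl, fun u hu hne => ?_⟩
  obtain ⟨π, hπ, hπz, hπu⟩ := hKr u ⟨limitSet_mono h₀ hu, hne⟩
  exact ⟨π, hstab z hz π hπ hπz, hπz, hπu⟩

theorem mem_limitSet_of_tendsto (hP : SymmPingPong G₀ J F B) (hd : IsDiscreteConvGroup G₀)
    (hJ : ∀ s, IsGeomFinite (J s)) (hG : IsConvGroup (G₀ ⊔ Subgroup.zpowers (F true)))
    (hgf : IsGeomFinite (G₀ ⊔ Subgroup.zpowers (F true)) ∨ IsGeomFinite G₀)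
    {h : ℕ → M ≃ₜ M} (hh : ∀ k, h k ∈ G₀) (hcos : ∀ m n, m ≠ n → (h m)⁻¹ * h n ∉ J s)
    {y : ℕ → M} (hy : ∀ k, y k ∈ B s) (hx : Tendsto (fun k => h k (y k)) atTop (𝓝 x)) :
    x ∈ limitSet G₀ := by
  have hle : G₀ ≤ G₀ ⊔ Subgroup.zpowers (F true) := le_sup_left
  have hstab : ∀ z ∈ limitSet (J s), ∀ g ∈ G₀ ⊔ Subgroup.zpowers (F true), g z = z → g ∈ J s :=
    fun z hz g hg hgz => hP.mem_of_fixed hz hg hgz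
  have hstab₀ : ∀ z ∈ limitSet (J s), ∀ g ∈ G₀, g z = z → g ∈ J s :=
    fun z hz g hg => hstab z hz g (hle hg)
  refine mem_limitSet_of_tendsto_translates hd (hP.le s) (hJ s) (hP.closed s) (hP.inv s)
    (fun x hx hxB => hP.lim s ▸ ⟨hx, hxB⟩) hstab₀ (fun z hz hp => ?_) hh hcos hy hx
  rcases hgf with hgf | hgf
  · exact exists_isClosed_of_isParabolicPt (hP.isDiscreteConvGroup hd hG hh hcos) hgf hle
      ((hP.le s).trans hle) hstab hz hp
  · exact exists_isClosed_of_isParabolicPt hd hgf le_rfl (hP.le s) hstab₀ hz hp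

/-- A convergence sequence of reduced words whose attracting point is not a limit point of `G₀`
has a subsequence along which the attracting point lies in the translates containing the images. -/
theorem exists_subseq_mem (hP : SymmPingPong G₀ J F B) (hd : IsDiscreteConvGroup G₀)
    (hJ : ∀ s, IsGeomFinite (J s)) (hG : IsConvGroup (G₀ ⊔ Subgroup.zpowers (F true)))
    (hgf : IsGeomFinite (G₀ ⊔ Subgroup.zpowers (F true)) ∨ IsGeomFinite G₀)
    {g : ℕ → M ≃ₜ M} {zm : M} (hg : IsConvSeq g x zm) (hx : x ∉ limitSet G₀)
    {P : (M ≃ₜ M) → Bool → Prop} (hred : ∀ n, ∃ h s k t, Red G₀ J F (g n) h s k t ∧ P h s) :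
    ∃ φ : ℕ → ℕ, StrictMono φ ∧ ∀ n, ∃ h s k t, Red G₀ J F (g (φ n)) h s k t ∧ P h s ∧
      h⁻¹ x ∈ B s := by
  choose h s k t hr hPh using hred
  have hconst : ∀ v : ℕ → Bool, ∃ φ : ℕ → ℕ, StrictMono φ ∧ ∃ a, ∀ n, v (φ n) = a := fun v => by
    obtain ⟨φ, hφ, h | h⟩ := exists_strictMono_or fun n => (v n).eq_false_or_eq_true
    · exact ⟨φ, hφ, _, h⟩
    · exact ⟨φ, hφ, _, h⟩
  obtain ⟨φ₁, hφ₁, s₀, hs⟩ := hconst s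
  obtain ⟨φ₂, hφ₂, t₀, ht⟩ := hconst (t ∘ φ₁)
  obtain ⟨φ₃, hφ₃, hcos⟩ := exists_strictMono_coset (J s₀) (h ∘ φ₁ ∘ φ₂)
  set φ := φ₁ ∘ φ₂ ∘ φ₃ with hφdef
  have hφ : StrictMono φ := hφ₁.comp (hφ₂.comp hφ₃)
  have hsφ : ∀ n, s (φ n) = s₀ := fun n => hs _
  have htφ : ∀ n, t (φ n) = t₀ := fun n => ht _
  obtain ⟨y, hy, hyz⟩ := (hP.nontrivial t₀).exists_ne zm
  have hmem : ∀ n, (h (φ n))⁻¹ (g (φ n) y) ∈ B s₀ := fun n => by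
    have hrn := hr (φ n)
    rw [hsφ, htφ] at hrn
    refine interior_subset (hP.red_mem_interior hrn fun hc => ?_)
    exact absurd (hP.prec _ _ _ hrn.right_mem y (interior_subset hy) hc).1 (by simp)
  have hlim : Tendsto (fun n => h (φ n) ((h (φ n))⁻¹ (g (φ n) y))) atTop (𝓝 x) := by
    simp only [app_inv]
    exact (hg.comp hφ).tendsto_const hyz
  rcases hcos with hcos | hcos
  · have hcos' : ∀ n, (h (φ 0))⁻¹ * h (φ n) ∈ J s₀ := hcos
    have h0 : (h (φ 0))⁻¹ x ∈ B s₀ := by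
      refine (hP.closed s₀).mem_of_tendsto (((h (φ 0))⁻¹.continuous.tendsto x).comp hlim)
        (Eventually.of_forall fun n => ?_)
      exact hP.inv s₀ _ (hcos' n) _ (hmem n)
    refine ⟨φ, hφ, fun n => ⟨_, _, _, _, hr (φ n), hPh _, ?_⟩⟩
    have := hP.inv s₀ _ ((J s₀).inv_mem (hcos' n)) _ h0
    rw [mul_inv_rev, inv_inv, mul_app, app_inv] at this
    rwa [hsφ]
  · exact (hx (hP.mem_limitSet_of_tendsto hd hJ hG hgf (fun n => (hr (φ n)).left_mem) hcos
      hmem hlim)).elim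

theorem limitSet_inter_frontier (hP : SymmPingPong G₀ J F B) (hd : IsDiscreteConvGroup G₀)
    (hJ : ∀ s, IsGeomFinite (J s)) (hG : IsConvGroup (G₀ ⊔ Subgroup.zpowers (F true)))
    (hgf : IsGeomFinite (G₀ ⊔ Subgroup.zpowers (F true)) ∨ IsGeomFinite G₀) (s : Bool) :
    limitSet (G₀ ⊔ Subgroup.zpowers (F true)) ∩ frontier (B s) = limitSet (J s) := by
  have hfr : frontier (B s) = B s \ interior (B s) := (hP.closed s).frontier_eq
  refine Subset.antisymm ?_ fun x hx => ⟨limitSet_mono ((hP.le s).trans le_sup_left) hx,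
    hfr ▸ ⟨hP.limitSet_subset hx, hP.notMem_interior s x hx⟩⟩
  rintro x ⟨⟨g, hg, hi, zm, hc⟩, hxf⟩
  rw [hfr] at hxf
  obtain ⟨hxB, hxI⟩ := hxf
  by_contra hxJ
  have hx₀ : x ∉ limitSet G₀ := fun h => hxJ (hP.lim s ▸ ⟨h, hxB⟩)
  obtain ⟨φ, hφ, hφg | hφg⟩ := exists_strictMono_or fun n => hP.mem_or_red (hg n)
  · exact hx₀ ⟨_, hφg, hi.comp hφ.injective, zm, hc.comp hφ⟩
  obtain ⟨ψ, hψ, hψg⟩ := hP.exists_subseq_mem hd hJ hG hgf (P := fun _ _ => True) (hc.comp hφ) hx₀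
    (fun n => by simpa using hφg n)
  have hconv := ((hc.comp hφ).comp hψ).mul_left (F s)⁻¹
  have hinj : Function.Injective fun n => (F s)⁻¹ * ((g ∘ φ) ∘ ψ) n :=
    (mul_right_injective _).comp ((hi.comp hφ.injective).comp hψ.injective)
  have hx'B := hP.inv_F_mem hxI
  have hx'₀ : (F s)⁻¹ x ∉ limitSet G₀ := fun h => hxJ (by
    simpa [app_inv] using hP.F_mem_limitSet ((hP.lim (!s)).subset ⟨h, hx'B⟩))
  have hnext : ∀ n, (F s)⁻¹ * ((g ∘ φ) ∘ ψ) n ∈ G₀ ∨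
      ∃ h' s' k t, Red G₀ J F ((F s)⁻¹ * ((g ∘ φ) ∘ ψ) n) h' s' k t ∧
        ¬(s' = !s ∧ h' ∈ J s') := fun n => by
    obtain ⟨h, s', k, t, hr, -, hxh⟩ := hψg n
    obtain ⟨rfl, hh⟩ := hP.prec s' s h hr.left_mem _ hxh (by rwa [app_inv])
    exact (hP.inv_F_mul_red hr hh).imp_right fun ⟨h', s', h⟩ => ⟨h', s', k, t, h⟩
  obtain ⟨χ, hχ, hχg | hχg⟩ := exists_strictMono_or hnext
  · exact hx'₀ ⟨_, hχg, hinj.comp hχ.injective, zm, hconv.comp hχ⟩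
  obtain ⟨ω, -, hω⟩ := hP.exists_subseq_mem hd hJ hG hgf
    (P := fun h' s' => ¬(s' = !s ∧ h' ∈ J s')) (hconv.comp hχ) hx'₀ hχg
  obtain ⟨h, s', k, t, hr, hn, hxh⟩ := hω 0
  obtain ⟨rfl, hh⟩ := hP.prec s' (!s) h hr.left_mem _ hxh (by rwa [app_inv])
  exact hn ⟨rfl, hh⟩

end SymmPingPong

theorem HNNPingPong.symmPingPong [CompactSpace M] [T2Space M] [Infinite M]
    {G₀ J₁ Jm : Subgroup (M ≃ₜ M)} {f : M ≃ₜ M}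
    {B₁ Bm : Set M} (h : HNNPingPong G₀ J₁ Jm f B₁ Bm) (hJ₁ : J₁ ≤ G₀) (hJm : Jm ≤ G₀)
    (hconj : ∀ x : M ≃ₜ M, x ∈ J₁ ↔ f⁻¹ * x * f ∈ Jm) :
    SymmPingPong G₀ (fun s => cond s J₁ Jm) (fun s => cond s f f⁻¹) (fun s => cond s B₁ Bm) := by
  have hcross : ∀ g ∈ G₀, ∀ x ∈ B₁, g x ∉ Bm := fun g hg x hx hc =>
    (h.cross g hg).subset ⟨mem_image_of_mem _ hx, hc⟩
  have hcross' : ∀ g ∈ G₀, ∀ x ∈ Bm, g x ∉ B₁ := fun g hg x hx hc =>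
    hcross _ (G₀.inv_mem hg) _ hc (by rwa [inv_app])
  have hdis : ∀ x ∈ B₁, x ∉ Bm := fun x hx => hcross 1 G₀.one_mem x hx
  have hf : ∀ x, f x ∈ interior B₁ ↔ x ∉ Bm := fun x => by
    rw [← h.mapf, f.injective.mem_set_image]
    have := hdis x
    simp only [mem_union, mem_compl_iff]
    tauto
  have hconj' : ∀ x : M ≃ₜ M, x ∈ Jm ↔ f * x * f⁻¹ ∈ J₁ := fun x => by
    rw [hconj]
    simp [mul_assoc]
  obtain ⟨p, hp⟩ := h.proper
  have hpB : p ∉ B₁ ∧ p ∉ Bm := by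
    simp only [mem_compl_iff, mem_iUnion, not_exists] at hp
    have := fun hc => hp 1 G₀.one_mem ⟨p, hc, rfl⟩
    simpa [not_or] using this
  have hfm : ∀ x ∉ B₁, f⁻¹ x ∈ interior Bm := fun x hx => by
    have hsub : ⇑f ⁻¹' B₁ᶜ ⊆ Bm := fun y hy => by
      by_contra hc
      exact hy (interior_subset ((hf y).2 hc))
    refine interior_maximal hsub (h.isClosed₁.isOpen_compl.preimage f.continuous) ?_
    rwa [mem_preimage, app_inv]
  obtain ⟨b₁, hb₁⟩ := h.int_nonempty₁
  obtain ⟨bm, hbm⟩ := h.int_nonemptym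
  have hnt₁ : (interior B₁).Nontrivial :=
    ⟨_, (hf p).2 hpB.2, _, (hf b₁).2 (hdis _ (interior_subset hb₁)),
      fun hc => hpB.1 (f.injective hc ▸ interior_subset hb₁)⟩
  have hntm : (interior Bm).Nontrivial :=
    ⟨_, hfm p hpB.1, _, hfm bm (fun hc => hdis _ hc (interior_subset hbm)),
      fun hc => hpB.2 ((f⁻¹).injective hc ▸ interior_subset hbm)⟩
  refine ⟨?_, ?_, ?_, ?_, ?_, ?_, ?_, ?_, ?_, ?_⟩
  · rintro (_ | _)
    exacts [hJm, hJ₁]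
  · rintro (_ | _)
    exacts [h.isClosedm, h.isClosed₁]
  · rintro (_ | _) j hj x hx
    · exact (h.invm j hj).subset (mem_image_of_mem _ hx)
    · exact (h.inv₁ j hj).subset (mem_image_of_mem _ hx)
  · rintro (_ | _) (_ | _) g hg x hx hgx
    · exact ⟨rfl, by_contra fun hc => (h.precm g hg hc).subset ⟨mem_image_of_mem _ hx, hgx⟩⟩
    · exact (hcross' g hg x hx hgx).elim
    · exact (hcross g hg x hx hgx).elim
    · exact ⟨rfl, by_contra fun hc => (h.prec₁ g hg hc).subset ⟨mem_image_of_mem _ hx, hgx⟩⟩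
  · rintro (_ | _) <;> simp
  · rintro (_ | _) x hx
    exacts [hfm x hx, (hf x).2 hx]
  · rintro (_ | _) x
    exacts [by simpa using hconj' x, hconj x]
  · rintro (_ | _)
    exacts [h.limm, h.lim₁]
  · rintro (_ | _)
    exacts [hntm, hnt₁]
  · rintro (_ | _) x hx hxI
    · have hfx : f x ∈ limitSet J₁ :=
        app_mem_limitSet_of_conj (fun q hq => (hconj' q).1 hq) hx
      obtain ⟨g, hg, -, zm, hc⟩ := hfx
      obtain ⟨y, hy, hyz⟩ := hnt₁.exists_ne zm
      have hU : ⇑f '' interior Bm ∈ 𝓝 (f x) :=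
        (f.isOpenMap _ isOpen_interior).mem_nhds (mem_image_of_mem _ hxI)
      obtain ⟨n, hn⟩ := ((hc.tendsto_const hyz).eventually hU).exists
      obtain ⟨w, hw, hwn⟩ := hn
      refine (hf w).1 ?_ (interior_subset hw)
      have := mem_image_of_mem (g n) hy
      rwa [(g n).image_interior, h.inv₁ _ (hg n), ← hwn] at this
    · have hfx : f⁻¹ x ∈ limitSet Jm :=
        app_mem_limitSet_of_conj (fun q hq => by simpa using (hconj q).1 hq) hx
      rw [← h.limm] at hfx
      exact (hf (f⁻¹ x)).1 (by rwa [app_inv]) hfx.2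

end PingPong

/-- In the HNN ping-pong situation (with `Jm` playing the role of
`J₋₁` and `Bm` of `B₋₁`), if either `G` or `G₀` is geometrically finite, then the only
limit points of `G` in `∂B₁` are limit points of `J₁`, and the only limit points of `G`
in `∂B₋₁` are limit points of `J₋₁`:
`Λ(G) ∩ ∂B₁ = Λ(J₁)` and `Λ(G) ∩ ∂B₋₁ = Λ(J₋₁)`. -/
theorem statement_19 {M : Type*} [TopologicalSpace M] [CompactSpace M]
    [TopologicalSpace.MetrizableSpace M]
    (G₀ J₁ Jm G : Subgroup (M ≃ₜ M)) (f : M ≃ₜ M)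
    (hd₀ : IsDiscreteConvGroup G₀)
    (hJ₁G₀ : J₁ ≤ G₀) (hJmG₀ : Jm ≤ G₀)
    (hJ₁gf : IsGeomFinite J₁) (hJmgf : IsGeomFinite Jm)
    (hford : ¬IsOfFinOrder f) (hfd : IsDiscreteConvGroup (Subgroup.zpowers f))
    (hconj : ∀ x : M ≃ₜ M, x ∈ J₁ ↔ f⁻¹ * x * f ∈ Jm)
    (B₁ Bm : Set M) (hpp : HNNPingPong G₀ J₁ Jm f B₁ Bm)
    (hG : G = G₀ ⊔ Subgroup.zpowers f) (hGconv : IsConvGroup G)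
    (hgf : IsGeomFinite G ∨ IsGeomFinite G₀) :
    limitSet G ∩ frontier B₁ = limitSet J₁ ∧
      limitSet G ∩ frontier Bm = limitSet Jm := by
  have hM : Infinite M := not_finite_iff_infinite.1 fun _ => by
    have : Finite (M ≃ₜ M) := DFunLike.finite _
    exact hford (isOfFinOrder_of_finite f)
  let _ := TopologicalSpace.metrizableSpaceMetric M
  have hP := hpp.symmPingPong hJ₁G₀ hJmG₀ hconj
  subst hG
  have hJ : ∀ s, IsGeomFinite (cond s J₁ Jm) := by
    rintro (_ | _)
    exacts [hJmgf, hJ₁gf]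
  exact ⟨hP.limitSet_inter_frontier hd₀ hJ hGconv hgf true,
    hP.limitSet_inter_frontier hd₀ hJ hGconv hgf false⟩

end ConvergenceGroups
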